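/- arXiv:2507.07542 — 9 statements merged into one kernel-verified Lean document; each statement's English description precedes it below -/
import Mathlib

section
/- For each i ∈ {1,2,3}: ∂P_𝐚/∂x_i(σ_i(p)) = −∂P_𝐚/∂x_i(p) for every p ∈ ℂ³, and the total derivative Dσ_i(p) fixes the two coordinates x_j, x_k (j,k the indices different from i). Consequently, for every p with ∂P_𝐚/∂x_i(p) ≠ 0 and all u, v ∈ ℂ³, with w = Dσ_i(p)u and z = Dσ_i(p)v, one has (w_j z_k − w_k z_j)/(∂P_𝐚/∂x_i(σ_i(p))) = −(u_j v_k − u_k v_j)/(∂P_𝐚/∂x_i(p)); i.e. σ_i pulls back the symplectic form Ω = dx_j∧dx_k/P_{x_i} to −Ω. -/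
noncomputable section

/-- Partial derivative `P_{x1} = 2x1 + x2x3 − a1` of `P_𝐚`. -/
def Px1 (a₁ : ℂ) (p : ℂ × ℂ × ℂ) : ℂ := 2 * p.1 + p.2.1 * p.2.2 - a₁

/-- Partial derivative `P_{x2} = 2x2 + x1x3 − a2` of `P_𝐚`. -/
def Px2 (a₂ : ℂ) (p : ℂ × ℂ × ℂ) : ℂ := 2 * p.2.1 + p.1 * p.2.2 - a₂

/-- Partial derivative `P_{x3} = 2x3 + x1x2 − a3` of `P_𝐚`. -/
def Px3 (a₃ : ℂ) (p : ℂ × ℂ × ℂ) : ℂ := 2 * p.2.2 + p.1 * p.2.1 - a₃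

/-- The involution `σ₁`. -/
def sigma1 (a₁ : ℂ) (x : ℂ × ℂ × ℂ) : ℂ × ℂ × ℂ :=
  (a₁ - x.1 - x.2.1 * x.2.2, x.2.1, x.2.2)

/-- The involution `σ₂`. -/
def sigma2 (a₂ : ℂ) (x : ℂ × ℂ × ℂ) : ℂ × ℂ × ℂ :=
  (x.1, a₂ - x.2.1 - x.1 * x.2.2, x.2.2)

/-- The involution `σ₃`. -/
def sigma3 (a₃ : ℂ) (x : ℂ × ℂ × ℂ) : ℂ × ℂ × ℂ :=
  (x.1, x.2.1, a₃ - x.2.2 - x.1 * x.2.1)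

theorem fderiv_fixes (f : ℂ × ℂ × ℂ → ℂ × ℂ × ℂ) (L : ℂ × ℂ × ℂ →L[ℂ] ℂ)
    (p u : ℂ × ℂ × ℂ) (hf : DifferentiableAt ℂ f p) (h : ∀ x, L (f x) = L x) :
    L (fderiv ℂ f p u) = L u := by
  have h1 : HasFDerivAt (fun x => L (f x)) (L.comp (fderiv ℂ f p)) p :=
    L.hasFDerivAt.comp p hf.hasFDerivAt
  have h2 : HasFDerivAt (fun x => L (f x)) L p := by
    simp only [h]
    exact L.hasFDerivAt
  exact congrArg (fun M : ℂ × ℂ × ℂ →L[ℂ] ℂ => M u) (h1.unique h2)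

abbrev coordA : ℂ × ℂ × ℂ →L[ℂ] ℂ := ContinuousLinearMap.fst ℂ ℂ (ℂ × ℂ)
abbrev coordB : ℂ × ℂ × ℂ →L[ℂ] ℂ :=
  (ContinuousLinearMap.fst ℂ ℂ ℂ).comp (ContinuousLinearMap.snd ℂ ℂ (ℂ × ℂ))
abbrev coordC : ℂ × ℂ × ℂ →L[ℂ] ℂ :=
  (ContinuousLinearMap.snd ℂ ℂ ℂ).comp (ContinuousLinearMap.snd ℂ ℂ (ℂ × ℂ))

/-- For each `i`: `P_{x_i}(σ_i(p)) = −P_{x_i}(p)`, the total derivative `Dσ_i(p)` fixes the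
coordinates `x_j, x_k` (`j,k ≠ i`), and consequently `σ_i` pulls back the symplectic form
`Ω = dx_j∧dx_k / P_{x_i}` to `−Ω`. -/
theorem stmt2 (a₁ a₂ a₃ : ℂ) :
    -- case i = 1, (j,k) = (2,3)
    ((∀ p : ℂ × ℂ × ℂ, Px1 a₁ (sigma1 a₁ p) = - Px1 a₁ p) ∧
     (∀ p u : ℂ × ℂ × ℂ,
        (fderiv ℂ (sigma1 a₁) p u).2.1 = u.2.1 ∧ (fderiv ℂ (sigma1 a₁) p u).2.2 = u.2.2) ∧
     (∀ p : ℂ × ℂ × ℂ, Px1 a₁ p ≠ 0 → ∀ u v : ℂ × ℂ × ℂ,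
        ((fderiv ℂ (sigma1 a₁) p u).2.1 * (fderiv ℂ (sigma1 a₁) p v).2.2
          - (fderiv ℂ (sigma1 a₁) p u).2.2 * (fderiv ℂ (sigma1 a₁) p v).2.1)
            / Px1 a₁ (sigma1 a₁ p) =
          -((u.2.1 * v.2.2 - u.2.2 * v.2.1) / Px1 a₁ p))) ∧
    -- case i = 2, (j,k) = (3,1)
    ((∀ p : ℂ × ℂ × ℂ, Px2 a₂ (sigma2 a₂ p) = - Px2 a₂ p) ∧
     (∀ p u : ℂ × ℂ × ℂ,
        (fderiv ℂ (sigma2 a₂) p u).2.2 = u.2.2 ∧ (fderiv ℂ (sigma2 a₂) p u).1 = u.1) ∧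
     (∀ p : ℂ × ℂ × ℂ, Px2 a₂ p ≠ 0 → ∀ u v : ℂ × ℂ × ℂ,
        ((fderiv ℂ (sigma2 a₂) p u).2.2 * (fderiv ℂ (sigma2 a₂) p v).1
          - (fderiv ℂ (sigma2 a₂) p u).1 * (fderiv ℂ (sigma2 a₂) p v).2.2)
            / Px2 a₂ (sigma2 a₂ p) =
          -((u.2.2 * v.1 - u.1 * v.2.2) / Px2 a₂ p))) ∧
    -- case i = 3, (j,k) = (1,2)
    ((∀ p : ℂ × ℂ × ℂ, Px3 a₃ (sigma3 a₃ p) = - Px3 a₃ p) ∧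
     (∀ p u : ℂ × ℂ × ℂ,
        (fderiv ℂ (sigma3 a₃) p u).1 = u.1 ∧ (fderiv ℂ (sigma3 a₃) p u).2.1 = u.2.1) ∧
     (∀ p : ℂ × ℂ × ℂ, Px3 a₃ p ≠ 0 → ∀ u v : ℂ × ℂ × ℂ,
        ((fderiv ℂ (sigma3 a₃) p u).1 * (fderiv ℂ (sigma3 a₃) p v).2.1
          - (fderiv ℂ (sigma3 a₃) p u).2.1 * (fderiv ℂ (sigma3 a₃) p v).1)
            / Px3 a₃ (sigma3 a₃ p) =
          -((u.1 * v.2.1 - u.2.1 * v.1) / Px3 a₃ p))) := by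
  have d1 : ∀ p, DifferentiableAt ℂ (sigma1 a₁) p := by
    intro p
    unfold sigma1
    fun_prop
  have s1 : ∀ p : ℂ × ℂ × ℂ, Px1 a₁ (sigma1 a₁ p) = - Px1 a₁ p := by
    intro p
    simp only [Px1, sigma1]
    ring
  have j1 := fun p u => fderiv_fixes (sigma1 a₁) coordB p u (d1 p) (fun _ => rfl)
  have k1 := fun p u => fderiv_fixes (sigma1 a₁) coordC p u (d1 p) (fun _ => rfl)
  simp only [ContinuousLinearMap.comp_apply, ContinuousLinearMap.coe_fst',
    ContinuousLinearMap.coe_snd'] at j1 k1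
  have d2 : ∀ p, DifferentiableAt ℂ (sigma2 a₂) p := by
    intro p
    unfold sigma2
    fun_prop
  have s2 : ∀ p : ℂ × ℂ × ℂ, Px2 a₂ (sigma2 a₂ p) = - Px2 a₂ p := by
    intro p
    simp only [Px2, sigma2]
    ring
  have j2 := fun p u => fderiv_fixes (sigma2 a₂) coordC p u (d2 p) (fun _ => rfl)
  have k2 := fun p u => fderiv_fixes (sigma2 a₂) coordA p u (d2 p) (fun _ => rfl)
  simp only [ContinuousLinearMap.comp_apply, ContinuousLinearMap.coe_fst',
    ContinuousLinearMap.coe_snd'] at j2 k2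
  have d3 : ∀ p, DifferentiableAt ℂ (sigma3 a₃) p := by
    intro p
    unfold sigma3
    fun_prop
  have s3 : ∀ p : ℂ × ℂ × ℂ, Px3 a₃ (sigma3 a₃ p) = - Px3 a₃ p := by
    intro p
    simp only [Px3, sigma3]
    ring
  have j3 := fun p u => fderiv_fixes (sigma3 a₃) coordA p u (d3 p) (fun _ => rfl)
  have k3 := fun p u => fderiv_fixes (sigma3 a₃) coordB p u (d3 p) (fun _ => rfl)
  simp only [ContinuousLinearMap.comp_apply, ContinuousLinearMap.coe_fst',
    ContinuousLinearMap.coe_snd'] at j3 k3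
  refine ⟨⟨s1, fun p u => ⟨j1 p u, k1 p u⟩, fun p _ u v => ?_⟩,
    ⟨s2, fun p u => ⟨j2 p u, k2 p u⟩, fun p _ u v => ?_⟩,
    ⟨s3, fun p u => ⟨j3 p u, k3 p u⟩, fun p _ u v => ?_⟩⟩
  · rw [s1, j1, j1, k1, k1, div_neg]
  · rw [s2, j2, j2, k2, k2, div_neg]
  · rw [s3, j3, j3, k3, k3, div_neg]
end
end

section
/- Let p, q be positive coprime integers, let t = 2·cos(πp/q) and assume t ≠ 2 and t ≠ −2. Then the affine map φ_t : ℂ² → ℂ², φ_t(x1,x2) = (−x1 − t·x2 + a1, t·x1 + (t² − 1)·x2 + a2 − a1·t), satisfies φ_t^{(2q)} = id (the 2q-fold iterate of φ_t is the identity of ℂ²). -/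
noncomputable section

open Function

lemma aux_iter (w v t a₁ a₂ : ℂ) (hwv : w * v = 1) (ht : t = w + v) (hw : w ^ 2 ≠ 1) (n : ℕ)
    (z : ℂ × ℂ) (f : ℂ) (hf : f * (1 - w ^ 2) = a₁ + w * (a₂ - a₁ * t)) :
    ((fun z : ℂ × ℂ =>
        (-z.1 - t * z.2 + a₁, t * z.1 + (t ^ 2 - 1) * z.2 + a₂ - a₁ * t))^[n] z).1
    + w * ((fun z : ℂ × ℂ =>
        (-z.1 - t * z.2 + a₁, t * z.1 + (t ^ 2 - 1) * z.2 + a₂ - a₁ * t))^[n] z).2 - f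
    = (w ^ 2) ^ n * (z.1 + w * z.2 - f) := by
  induction n with
  | zero => simp
  | succ n ih =>
    rw [Function.iterate_succ_apply', pow_succ' (w ^ 2) n, mul_assoc (w ^ 2)]
    generalize ((fun z : ℂ × ℂ =>
        (-z.1 - t * z.2 + a₁, t * z.1 + (t ^ 2 - 1) * z.2 + a₂ - a₁ * t))^[n] z) = y at ih ⊢
    rw [← ih]
    have h1 : w * t = w ^ 2 + 1 := by rw [ht]; linear_combination hwv
    have h2 : w * (t ^ 2 - 1) - t = w ^ 3 := by
      rw [ht]; linear_combination (2 * w + v) * hwv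
    simp only
    linear_combination y.1 * h1 + y.2 * h2 - hf

lemma aux_full (w v t a₁ a₂ : ℂ) (hwv : w * v = 1) (ht : t = w + v) (hw : w ^ 2 ≠ 1) (n : ℕ)
    (hn : (w ^ 2) ^ n = 1) (z : ℂ × ℂ) :
    ((fun z : ℂ × ℂ =>
        (-z.1 - t * z.2 + a₁, t * z.1 + (t ^ 2 - 1) * z.2 + a₂ - a₁ * t))^[n] z).1
    + w * ((fun z : ℂ × ℂ =>
        (-z.1 - t * z.2 + a₁, t * z.1 + (t ^ 2 - 1) * z.2 + a₂ - a₁ * t))^[n] z).2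
    = z.1 + w * z.2 := by
  have h0 : 1 - w ^ 2 ≠ 0 := fun h => hw (by linear_combination -h)
  have := aux_iter w v t a₁ a₂ hwv ht hw n z _ (div_mul_cancel₀ _ h0)
  rw [hn] at this
  linear_combination this

/-- If `t = 2cos(πp/q)` with `p, q` positive coprime integers and `t ≠ ±2`, then the affine
map `φ_t(x1,x2) = (−x1 − t·x2 + a1, t·x1 + (t² − 1)·x2 + a2 − a1·t)` satisfies
`φ_t^{2q} = id`. -/
theorem stmt4 (p q : ℕ) (hp : 0 < p) (hq : 0 < q) (hpq : Nat.Coprime p q)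
    (a₁ a₂ : ℂ) (t : ℂ) (ht : t = 2 * Complex.cos (Real.pi * p / q))
    (ht2 : t ≠ 2) (ht2' : t ≠ -2) :
    (fun z : ℂ × ℂ =>
        (-z.1 - t * z.2 + a₁, t * z.1 + (t ^ 2 - 1) * z.2 + a₂ - a₁ * t))^[2 * q] = id := by
  obtain ⟨w, v, hwv, htw, hw1⟩ : ∃ w v : ℂ, w * v = 1 ∧ t = w + v ∧ w ^ (2 * q) = 1 := by
    refine ⟨Complex.exp (Real.pi * p / q * Complex.I),
      Complex.exp (-(Real.pi * p / q) * Complex.I), ?_, ?_, ?_⟩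
    · rw [← Complex.exp_add]; simp
    · rw [ht, Complex.two_cos]
    · rw [← Complex.exp_nat_mul, Complex.exp_eq_one_iff]
      refine ⟨p, ?_⟩
      have : (q : ℂ) ≠ 0 := by exact_mod_cast hq.ne'
      push_cast
      field_simp
  have hw : w ^ 2 ≠ 1 := by
    intro h
    rcases mul_eq_zero.mp (show (w - 1) * (w + 1) = 0 by linear_combination h) with h | h
    · exact ht2 (by rw [htw]; linear_combination (1 - v) * h + hwv)
    · exact ht2' (by rw [htw]; linear_combination (1 + v) * h - hwv)
  have hv : v ^ 2 ≠ 1 := by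
    intro h
    apply hw
    linear_combination (w * v + 1) * hwv - w ^ 2 * h
  have hv1 : v ^ (2 * q) = 1 := by
    have : (w * v) ^ (2 * q) = 1 := by rw [hwv, one_pow]
    rwa [mul_pow, hw1, one_mul] at this
  have hne : w - v ≠ 0 := by
    intro h
    apply hw
    linear_combination w * h + hwv
  funext z
  have e1 := aux_full w v t a₁ a₂ hwv htw hw (2 * q) (by rw [pow_right_comm, hw1, one_pow]) z
  have e2 := aux_full v w t a₁ a₂ (by rw [mul_comm, hwv]) (by rw [htw, add_comm]) hv (2 * q)
    (by rw [pow_right_comm, hv1, one_pow]) z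
  generalize ((fun z : ℂ × ℂ =>
        (-z.1 - t * z.2 + a₁, t * z.1 + (t ^ 2 - 1) * z.2 + a₂ - a₁ * t))^[2 * q] z) = y at e1 e2 ⊢
  have h2 : y.2 = z.2 := mul_left_cancel₀ hne (by linear_combination e1 - e2)
  have h1 : y.1 = z.1 := by rw [h2] at e1; linear_combination e1
  exact Prod.ext h1 h2
end
end

section
/- Let U ⊂ ℂ² be open and for i = 1,2,3 let ω_i = a_i·dx + b_i·dy be nonvanishing holomorphic 1-forms on U with a_1 + a_2 + a_3 = 0, b_1 + b_2 + b_3 = 0, and with (a_1,b_1), (a_2,b_2) pointwise independent. Then there exist unique holomorphic functions p, q : U → ℂ (the coefficients of θ = p·dx + q·dy) such that ∂_x b_i − ∂_y a_i = p·b_i − q·a_i on U for every i = 1,2,3 (i.e. dω_i = θ ∧ ω_i for i = 1,2,3). -/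
noncomputable section

/-- Partial derivative in the first variable. -/
def pdx (f : ℂ × ℂ → ℂ) (z : ℂ × ℂ) : ℂ := deriv (fun x => f (x, z.2)) z.1

/-- Partial derivative in the second variable. -/
def pdy (f : ℂ × ℂ → ℂ) (z : ℂ × ℂ) : ℂ := deriv (fun y => f (z.1, y)) z.2

theorem pdx_eq_fderiv {f : ℂ × ℂ → ℂ} {z : ℂ × ℂ} (hf : AnalyticAt ℂ f z) :
    pdx f z = fderiv ℂ f z (1, 0) := by
  have h1 : HasDerivAt (fun x : ℂ => (x, z.2)) ((1 : ℂ), (0 : ℂ)) z.1 :=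
    (hasDerivAt_id z.1).prodMk (hasDerivAt_const z.1 z.2)
  have h2 : HasFDerivAt f (fderiv ℂ f z) (z.1, z.2) := hf.differentiableAt.hasFDerivAt
  exact (h2.comp_hasDerivAt z.1 h1).deriv

theorem pdy_eq_fderiv {f : ℂ × ℂ → ℂ} {z : ℂ × ℂ} (hf : AnalyticAt ℂ f z) :
    pdy f z = fderiv ℂ f z (0, 1) := by
  have h1 : HasDerivAt (fun y : ℂ => (z.1, y)) ((0 : ℂ), (1 : ℂ)) z.2 :=
    (hasDerivAt_const z.2 z.1).prodMk (hasDerivAt_id z.2)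
  have h2 : HasFDerivAt f (fderiv ℂ f z) (z.1, z.2) := hf.differentiableAt.hasFDerivAt
  exact (h2.comp_hasDerivAt z.2 h1).deriv

theorem analytic_pd {U : Set (ℂ × ℂ)} {f : ℂ × ℂ → ℂ}
    (hf : AnalyticOnNhd ℂ f U) (v : ℂ × ℂ) :
    AnalyticOnNhd ℂ (fun z => fderiv ℂ f z v) U := fun z hz =>
  ((ContinuousLinearMap.apply ℂ ℂ v).analyticAt _).comp (hf.fderiv z hz)

theorem fderiv_third {U : Set (ℂ × ℂ)} (hU : IsOpen U) {f g h : ℂ × ℂ → ℂ}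
    (hf : AnalyticOnNhd ℂ f U) (hg : AnalyticOnNhd ℂ g U)
    (hs : ∀ z ∈ U, f z + g z + h z = 0) {z : ℂ × ℂ} (hz : z ∈ U) (v : ℂ × ℂ) :
    fderiv ℂ h z v = -(fderiv ℂ f z v + fderiv ℂ g z v) := by
  have e : h =ᶠ[nhds z] fun w => -(f w + g w) := by
    filter_upwards [hU.mem_nhds hz] with w hw
    linear_combination hs w hw
  have := ((hf z hz).differentiableAt.hasFDerivAt.fun_add
    (hg z hz).differentiableAt.hasFDerivAt).fun_neg
  rw [e.fderiv_eq, this.fderiv]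
  simp

/-- Given a normalized triple of 1-forms `ω_i = a_i·dx + b_i·dy` (with `ω₁+ω₂+ω₃ = 0`,
the first two pointwise independent), there exist unique holomorphic functions `p, q`
(coefficients of `θ = p·dx + q·dy`) with `dω_i = θ ∧ ω_i`, i.e.
`∂_x b_i − ∂_y a_i = p·b_i − q·a_i`, for `i = 1,2,3`. -/
theorem stmt9 (U : Set (ℂ × ℂ)) (hU : IsOpen U)
    (a₁ b₁ a₂ b₂ a₃ b₃ : ℂ × ℂ → ℂ)
    (ha₁ : AnalyticOnNhd ℂ a₁ U) (hb₁ : AnalyticOnNhd ℂ b₁ U)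
    (ha₂ : AnalyticOnNhd ℂ a₂ U) (hb₂ : AnalyticOnNhd ℂ b₂ U)
    (ha₃ : AnalyticOnNhd ℂ a₃ U) (hb₃ : AnalyticOnNhd ℂ b₃ U)
    (hnv₁ : ∀ z ∈ U, (a₁ z, b₁ z) ≠ (0, 0))
    (hnv₂ : ∀ z ∈ U, (a₂ z, b₂ z) ≠ (0, 0))
    (hnv₃ : ∀ z ∈ U, (a₃ z, b₃ z) ≠ (0, 0))
    (hsum : ∀ z ∈ U, a₁ z + a₂ z + a₃ z = 0 ∧ b₁ z + b₂ z + b₃ z = 0)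
    (h12 : ∀ z ∈ U, a₁ z * b₂ z - a₂ z * b₁ z ≠ 0) :
    (∃ p q : ℂ × ℂ → ℂ, AnalyticOnNhd ℂ p U ∧ AnalyticOnNhd ℂ q U ∧
      ∀ z ∈ U,
        pdx b₁ z - pdy a₁ z = p z * b₁ z - q z * a₁ z ∧
        pdx b₂ z - pdy a₂ z = p z * b₂ z - q z * a₂ z ∧
        pdx b₃ z - pdy a₃ z = p z * b₃ z - q z * a₃ z) ∧
    (∀ p q p' q' : ℂ × ℂ → ℂ,
      (∀ z ∈ U,
        pdx b₁ z - pdy a₁ z = p z * b₁ z - q z * a₁ z ∧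
        pdx b₂ z - pdy a₂ z = p z * b₂ z - q z * a₂ z ∧
        pdx b₃ z - pdy a₃ z = p z * b₃ z - q z * a₃ z) →
      (∀ z ∈ U,
        pdx b₁ z - pdy a₁ z = p' z * b₁ z - q' z * a₁ z ∧
        pdx b₂ z - pdy a₂ z = p' z * b₂ z - q' z * a₂ z ∧
        pdx b₃ z - pdy a₃ z = p' z * b₃ z - q' z * a₃ z) →
      ∀ z ∈ U, p z = p' z ∧ q z = q' z) := by
  constructor
  · let W₁ : ℂ × ℂ → ℂ := fun z => fderiv ℂ b₁ z (1, 0) - fderiv ℂ a₁ z (0, 1)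
    let W₂ : ℂ × ℂ → ℂ := fun z => fderiv ℂ b₂ z (1, 0) - fderiv ℂ a₂ z (0, 1)
    have hW₁ : AnalyticOnNhd ℂ W₁ U := (analytic_pd hb₁ _).sub (analytic_pd ha₁ _)
    have hW₂ : AnalyticOnNhd ℂ W₂ U := (analytic_pd hb₂ _).sub (analytic_pd ha₂ _)
    have hD : AnalyticOnNhd ℂ (fun z => a₁ z * b₂ z - a₂ z * b₁ z) U :=
      (ha₁.mul hb₂).sub (ha₂.mul hb₁)
    refine ⟨fun z => (a₁ z * W₂ z - a₂ z * W₁ z) / (a₁ z * b₂ z - a₂ z * b₁ z),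
      fun z => (b₁ z * W₂ z - b₂ z * W₁ z) / (a₁ z * b₂ z - a₂ z * b₁ z),
      ((ha₁.mul hW₂).sub (ha₂.mul hW₁)).div hD h12,
      ((hb₁.mul hW₂).sub (hb₂.mul hW₁)).div hD h12, ?_⟩
    intro z hz
    have hd := h12 z hz
    have e₁ : W₁ z = (a₁ z * W₂ z - a₂ z * W₁ z) / (a₁ z * b₂ z - a₂ z * b₁ z) * b₁ z
        - (b₁ z * W₂ z - b₂ z * W₁ z) / (a₁ z * b₂ z - a₂ z * b₁ z) * a₁ z := by
      generalize W₁ z = w₁, W₂ z = w₂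
      rw [div_mul_eq_mul_div, div_mul_eq_mul_div, ← sub_div, eq_div_iff hd]
      ring
    have e₂ : W₂ z = (a₁ z * W₂ z - a₂ z * W₁ z) / (a₁ z * b₂ z - a₂ z * b₁ z) * b₂ z
        - (b₁ z * W₂ z - b₂ z * W₁ z) / (a₁ z * b₂ z - a₂ z * b₁ z) * a₂ z := by
      generalize W₁ z = w₁, W₂ z = w₂
      rw [div_mul_eq_mul_div, div_mul_eq_mul_div, ← sub_div, eq_div_iff hd]
      ring
    rw [pdx_eq_fderiv (hb₁ z hz), pdx_eq_fderiv (hb₂ z hz), pdx_eq_fderiv (hb₃ z hz),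
      pdy_eq_fderiv (ha₁ z hz), pdy_eq_fderiv (ha₂ z hz), pdy_eq_fderiv (ha₃ z hz)]
    refine ⟨e₁, e₂, ?_⟩
    rw [fderiv_third hU hb₁ hb₂ (fun z hz => (hsum z hz).2) hz,
      fderiv_third hU ha₁ ha₂ (fun z hz => (hsum z hz).1) hz]
    obtain ⟨s₁, s₂⟩ := hsum z hz
    have t₁ : a₃ z = -(a₁ z + a₂ z) := by linear_combination s₁
    have t₂ : b₃ z = -(b₁ z + b₂ z) := by linear_combination s₂
    have k₁ : W₁ z = fderiv ℂ b₁ z (1, 0) - fderiv ℂ a₁ z (0, 1) := rfl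
    have k₂ : W₂ z = fderiv ℂ b₂ z (1, 0) - fderiv ℂ a₂ z (0, 1) := rfl
    simp only [t₁, t₂]
    linear_combination k₁ + k₂ - e₁ - e₂
  · intro p q p' q' h h' z hz
    obtain ⟨h1, h2, -⟩ := h z hz
    obtain ⟨h1', h2', -⟩ := h' z hz
    have hd := h12 z hz
    constructor
    · apply mul_right_cancel₀ hd
      linear_combination a₁ z * (h2' - h2) - a₂ z * (h1' - h1)
    · apply mul_right_cancel₀ hd
      linear_combination b₁ z * (h2' - h2) - b₂ z * (h1' - h1)
end
end

section
/- Let U ⊂ ℂ² be open, let ω_i = a_i·dx + b_i·dy (i = 1,2,3) be nonvanishing holomorphic 1-forms on U with a_1+a_2+a_3 = 0, b_1+b_2+b_3 = 0 and (a_1,b_1), (a_2,b_2) pointwise independent, and let f : U → ℂ be holomorphic and nowhere vanishing. If (p, q) are the unique holomorphic functions with ∂_x b_i − ∂_y a_i = p·b_i − q·a_i for i = 1,2,3, and (p̃, q̃) are the unique holomorphic functions with ∂_x(f·b_i) − ∂_y(f·a_i) = p̃·(f·b_i) − q̃·(f·a_i) for i = 1,2,3, then p̃ = p + (∂_x f)/f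 and q̃ = q + (∂_y f)/f; consequently ∂_x q̃ − ∂_y p̃ = ∂_x q − ∂_y p. Hence the Blaschke curvature κ = (∂_x q − ∂_y p)·dx∧dy depends only on the 3-web and not on the choice of normalized defining triple. -/
noncomputable section

theorem hx_pdx_eq {g : ℂ × ℂ → ℂ} {z : ℂ × ℂ} (h : DifferentiableAt ℂ g z) :
    pdx g z = fderiv ℂ g z (1, 0) := by
  have h1 : HasDerivAt (fun x : ℂ => (x, z.2)) ((1 : ℂ), (0 : ℂ)) z.1 :=
    (hasDerivAt_id z.1).prodMk (hasDerivAt_const z.1 z.2)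
  have h2 : HasFDerivAt g (fderiv ℂ g z) ((fun x : ℂ => (x, z.2)) z.1) := h.hasFDerivAt
  exact (h2.comp_hasDerivAt z.1 h1).deriv

theorem hx_pdy_eq {g : ℂ × ℂ → ℂ} {z : ℂ × ℂ} (h : DifferentiableAt ℂ g z) :
    pdy g z = fderiv ℂ g z (0, 1) := by
  have h1 : HasDerivAt (fun y : ℂ => (z.1, y)) ((0 : ℂ), (1 : ℂ)) z.2 :=
    (hasDerivAt_const z.2 z.1).prodMk (hasDerivAt_id z.2)
  have h2 : HasFDerivAt g (fderiv ℂ g z) ((fun y : ℂ => (z.1, y)) z.2) := h.hasFDerivAt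
  exact (h2.comp_hasDerivAt z.2 h1).deriv

theorem hx_pdx_congr {g h : ℂ × ℂ → ℂ} {U : Set (ℂ × ℂ)} (hU : IsOpen U)
    (e : ∀ z ∈ U, g z = h z) {z : ℂ × ℂ} (hz : z ∈ U) : pdx g z = pdx h z := by
  apply Filter.EventuallyEq.deriv_eq
  have hc : ContinuousAt (fun x : ℂ => (x, z.2)) z.1 := by fun_prop
  filter_upwards [hc (hU.mem_nhds hz)] with x hx using e _ hx

theorem hx_pdy_congr {g h : ℂ × ℂ → ℂ} {U : Set (ℂ × ℂ)} (hU : IsOpen U)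
    (e : ∀ z ∈ U, g z = h z) {z : ℂ × ℂ} (hz : z ∈ U) : pdy g z = pdy h z := by
  apply Filter.EventuallyEq.deriv_eq
  have hc : ContinuousAt (fun y : ℂ => (z.1, y)) z.2 := by fun_prop
  filter_upwards [hc (hU.mem_nhds hz)] with x hx using e _ hx

theorem hx_fd_an {g : ℂ × ℂ → ℂ} {U : Set (ℂ × ℂ)} (hg : AnalyticOnNhd ℂ g U) (v : ℂ × ℂ) :
    AnalyticOnNhd ℂ (fun w => fderiv ℂ g w v) U :=
  fun z hz => ((ContinuousLinearMap.apply ℂ ℂ v).analyticAt _).comp (hg.fderiv z hz)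

theorem hx_pdx_an {g : ℂ × ℂ → ℂ} {U : Set (ℂ × ℂ)} (hU : IsOpen U)
    (hg : AnalyticOnNhd ℂ g U) : AnalyticOnNhd ℂ (pdx g) U :=
  (hx_fd_an hg (1, 0)).congr hU fun z hz => (hx_pdx_eq (hg z hz).differentiableAt).symm

theorem hx_pdy_an {g : ℂ × ℂ → ℂ} {U : Set (ℂ × ℂ)} (hU : IsOpen U)
    (hg : AnalyticOnNhd ℂ g U) : AnalyticOnNhd ℂ (pdy g) U :=
  (hx_fd_an hg (0, 1)).congr hU fun z hz => (hx_pdy_eq (hg z hz).differentiableAt).symm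

theorem hx_symm {g : ℂ × ℂ → ℂ} {U : Set (ℂ × ℂ)} (hU : IsOpen U)
    (hg : AnalyticOnNhd ℂ g U) {z : ℂ × ℂ} (hz : z ∈ U) :
    pdx (pdy g) z = pdy (pdx g) z := by
  rw [hx_pdx_congr hU (fun w hw => hx_pdy_eq (hg w hw).differentiableAt) hz,
    hx_pdy_congr hU (fun w hw => hx_pdx_eq (hg w hw).differentiableAt) hz,
    hx_pdx_eq (hx_fd_an hg _ z hz).differentiableAt,
    hx_pdy_eq (hx_fd_an hg _ z hz).differentiableAt]
  have hd : DifferentiableAt ℂ (fderiv ℂ g) z := (hg.fderiv z hz).differentiableAt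
  have hs : IsSymmSndFDerivAt ℂ g z :=
    (hg z hz).contDiffAt.isSymmSndFDerivAt (n := ⊤) (by simp)
  rw [fderiv_clm_apply hd (differentiableAt_const _),
    fderiv_clm_apply hd (differentiableAt_const _)]
  simpa using hs.eq (1, 0) (0, 1)

theorem hx_pdx_mul {g h : ℂ × ℂ → ℂ} {z : ℂ × ℂ} (hg : DifferentiableAt ℂ g z)
    (hh : DifferentiableAt ℂ h z) :
    pdx (fun w => g w * h w) z = pdx g z * h z + g z * pdx h z := by
  rw [hx_pdx_eq (hg.fun_mul hh), hx_pdx_eq hg, hx_pdx_eq hh, fderiv_fun_mul hg hh]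
  simp
  ring

theorem hx_pdy_mul {g h : ℂ × ℂ → ℂ} {z : ℂ × ℂ} (hg : DifferentiableAt ℂ g z)
    (hh : DifferentiableAt ℂ h z) :
    pdy (fun w => g w * h w) z = pdy g z * h z + g z * pdy h z := by
  rw [hx_pdy_eq (hg.fun_mul hh), hx_pdy_eq hg, hx_pdy_eq hh, fderiv_fun_mul hg hh]
  simp
  ring

theorem hx_pdx_add {g h : ℂ × ℂ → ℂ} {z : ℂ × ℂ} (hg : DifferentiableAt ℂ g z)
    (hh : DifferentiableAt ℂ h z) :
    pdx (fun w => g w + h w) z = pdx g z + pdx h z := by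
  rw [hx_pdx_eq (hg.fun_add hh), hx_pdx_eq hg, hx_pdx_eq hh, fderiv_fun_add hg hh]
  simp

theorem hx_pdy_add {g h : ℂ × ℂ → ℂ} {z : ℂ × ℂ} (hg : DifferentiableAt ℂ g z)
    (hh : DifferentiableAt ℂ h z) :
    pdy (fun w => g w + h w) z = pdy g z + pdy h z := by
  rw [hx_pdy_eq (hg.fun_add hh), hx_pdy_eq hg, hx_pdy_eq hh, fderiv_fun_add hg hh]
  simp

/-- Changing a normalized triple `(ω_i)` to `(f·ω_i)` changes `θ = p·dx + q·dy` to
`θ + df/f`, i.e. `p̃ = p + f_x/f`, `q̃ = q + f_y/f`; hence the Blaschke curvature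
`κ = (∂_x q − ∂_y p)·dx∧dy` does not depend on the normalized triple. -/
theorem stmt10 (U : Set (ℂ × ℂ)) (hU : IsOpen U)
    (a₁ b₁ a₂ b₂ a₃ b₃ : ℂ × ℂ → ℂ)
    (ha₁ : AnalyticOnNhd ℂ a₁ U) (hb₁ : AnalyticOnNhd ℂ b₁ U)
    (ha₂ : AnalyticOnNhd ℂ a₂ U) (hb₂ : AnalyticOnNhd ℂ b₂ U)
    (ha₃ : AnalyticOnNhd ℂ a₃ U) (hb₃ : AnalyticOnNhd ℂ b₃ U)
    (hnv₁ : ∀ z ∈ U, (a₁ z, b₁ z) ≠ (0, 0))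
    (hnv₂ : ∀ z ∈ U, (a₂ z, b₂ z) ≠ (0, 0))
    (hnv₃ : ∀ z ∈ U, (a₃ z, b₃ z) ≠ (0, 0))
    (hsum : ∀ z ∈ U, a₁ z + a₂ z + a₃ z = 0 ∧ b₁ z + b₂ z + b₃ z = 0)
    (h12 : ∀ z ∈ U, a₁ z * b₂ z - a₂ z * b₁ z ≠ 0)
    (f : ℂ × ℂ → ℂ) (hf : AnalyticOnNhd ℂ f U) (hf0 : ∀ z ∈ U, f z ≠ 0)
    (p q : ℂ × ℂ → ℂ)
    (hpq : ∀ z ∈ U,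
        pdx b₁ z - pdy a₁ z = p z * b₁ z - q z * a₁ z ∧
        pdx b₂ z - pdy a₂ z = p z * b₂ z - q z * a₂ z ∧
        pdx b₃ z - pdy a₃ z = p z * b₃ z - q z * a₃ z)
    (p' q' : ℂ × ℂ → ℂ)
    (hpq' : ∀ z ∈ U,
        pdx (fun w => f w * b₁ w) z - pdy (fun w => f w * a₁ w) z
          = p' z * (f z * b₁ z) - q' z * (f z * a₁ z) ∧
        pdx (fun w => f w * b₂ w) z - pdy (fun w => f w * a₂ w) z
          = p' z * (f z * b₂ z) - q' z * (f z * a₂ z) ∧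
        pdx (fun w => f w * b₃ w) z - pdy (fun w => f w * a₃ w) z
          = p' z * (f z * b₃ z) - q' z * (f z * a₃ z)) :
    ∀ z ∈ U,
      p' z = p z + pdx f z / f z ∧
      q' z = q z + pdy f z / f z ∧
      pdx q' z - pdy p' z = pdx q z - pdy p z := by
  have key : ∀ z ∈ U, p' z = p z + pdx f z / f z ∧ q' z = q z + pdy f z / f z := by
    intro z hz
    obtain ⟨h1, h2, -⟩ := hpq z hz
    obtain ⟨k1, k2, -⟩ := hpq' z hz
    have df := (hf z hz).differentiableAt
    rw [hx_pdx_mul df (hb₁ z hz).differentiableAt, hx_pdy_mul df (ha₁ z hz).differentiableAt] at k1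
    rw [hx_pdx_mul df (hb₂ z hz).differentiableAt, hx_pdy_mul df (ha₂ z hz).differentiableAt] at k2
    have hD := h12 z hz
    have hz0 := hf0 z hz
    constructor
    · rw [← sub_eq_iff_eq_add', eq_div_iff hz0]
      apply mul_right_cancel₀ hD
      linear_combination a₂ z * k1 - a₁ z * k2 - f z * a₂ z * h1 + f z * a₁ z * h2
    · rw [← sub_eq_iff_eq_add', eq_div_iff hz0]
      apply mul_right_cancel₀ hD
      linear_combination b₂ z * k1 - b₁ z * k2 - f z * b₂ z * h1 + f z * b₁ z * h2
  have hDan : AnalyticOnNhd ℂ (fun w => a₁ w * b₂ w - a₂ w * b₁ w) U :=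
    (ha₁.mul hb₂).sub (ha₂.mul hb₁)
  have hc1 := (hx_pdx_an hU hb₁).sub (hx_pdy_an hU ha₁)
  have hc2 := (hx_pdx_an hU hb₂).sub (hx_pdy_an hU ha₂)
  have hp : AnalyticOnNhd ℂ p U := by
    refine (((hc2.mul ha₁).sub (hc1.mul ha₂)).div hDan h12).congr hU ?_
    intro z hz
    obtain ⟨h1, h2, -⟩ := hpq z hz
    simp only [Pi.div_apply, Pi.mul_apply, Pi.sub_apply]
    rw [h1, h2, div_eq_iff (h12 z hz)]
    ring
  have hq : AnalyticOnNhd ℂ q U := by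
    refine (((hc2.mul hb₁).sub (hc1.mul hb₂)).div hDan h12).congr hU ?_
    intro z hz
    obtain ⟨h1, h2, -⟩ := hpq z hz
    simp only [Pi.div_apply, Pi.mul_apply, Pi.sub_apply]
    rw [h1, h2, div_eq_iff (h12 z hz)]
    ring
  have hF : AnalyticOnNhd ℂ (fun w => pdy f w / f w) U := (hx_pdy_an hU hf).div hf hf0
  have hG : AnalyticOnNhd ℂ (fun w => pdx f w / f w) U := (hx_pdx_an hU hf).div hf hf0
  intro z hz
  refine ⟨(key z hz).1, (key z hz).2, ?_⟩
  have df := (hf z hz).differentiableAt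
  have dF := (hF z hz).differentiableAt
  have dG := (hG z hz).differentiableAt
  have hz0 := hf0 z hz
  rw [hx_pdx_congr hU (fun w hw => (key w hw).2) hz, hx_pdy_congr hU (fun w hw => (key w hw).1) hz,
    hx_pdx_add (hq z hz).differentiableAt dF, hx_pdy_add (hp z hz).differentiableAt dG]
  have e1 := hx_pdx_mul dF df
  have e2 := hx_pdy_mul dG df
  rw [hx_pdx_congr hU (fun w hw => div_mul_cancel₀ (pdy f w) (hf0 w hw)) hz] at e1
  rw [hx_pdy_congr hU (fun w hw => div_mul_cancel₀ (pdx f w) (hf0 w hw)) hz] at e2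
  have e3 := hx_symm hU hf hz
  have e4 : pdx (fun w => pdy f w / f w) z = pdy (fun w => pdx f w / f w) z := by
    apply mul_right_cancel₀ hz0
    have e5 : pdy f z / f z * pdx f z = pdx f z / f z * pdy f z := by ring
    linear_combination e2 - e1 + e3 - e5
  rw [e4]
  ring
end
end

section
/- Let U ⊂ ℂ² be open and let ω_i = a_i·dx + b_i·dy (i = 1,2,3) be pairwise pointwise independent nonvanishing holomorphic 1-forms on U with a_1+a_2+a_3 = 0 and b_1+b_2+b_3 = 0, and let (p,q) be the unique holomorphic functions with ∂_x b_i − ∂_y a_i = p·b_i − q·a_i for i = 1,2,3. Then ∂_x q − ∂_y p ≡ 0 on U if and only if every point of U has an open neighborhood V on which there exist holomorphic functions h_1, h_2 : V → ℂ and nowhere-vanishing holomorphic functions g_1, g_2, g_3 : V → ℂ such that (∂_x h_1, ∂_y h_1) = g_1·(a_1, b_1), (∂_x h_2, ∂_y h_2) = g_2·(a_2, b_2), and (∂_x(−h_1−h_2), ∂_y(−h_1−h_2)) = g_3·(a_3, b_3) on V. (I.e. the 3-web is locally parallelizable — sent by the local biholomorphism (h_1,h_2) to the parallel web (dx, dy,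 −dx−dy) — iff its Blaschke curvature vanishes.) -/
noncomputable section

open Topology in
theorem prim_analyticAt {E : Type*} [NormedAddCommGroup E] [NormedSpace ℂ E]
    {f : E → ℂ} {ω : E → E →L[ℂ] ℂ} {x : E} (hω : AnalyticAt ℂ ω x)
    (hf : ∀ᶠ y in 𝓝 x, HasFDerivAt f (ω y) y) : AnalyticAt ℂ f x := by
  obtain ⟨P, r₀, hP₀⟩ := hω
  obtain ⟨ε, hε, hball⟩ := Metric.eventually_nhds_iff_ball.1 hf
  obtain ⟨r, hr, hrε, hP⟩ : ∃ r : ENNReal, 0 < r ∧ r ≤ ENNReal.ofReal ε ∧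
      HasFPowerSeriesOnBall ω P x r :=
    ⟨min r₀ (ENNReal.ofReal ε), lt_min hP₀.r_pos (ENNReal.ofReal_pos.2 hε), min_le_right _ _,
      hP₀.mono (lt_min hP₀.r_pos (ENNReal.ofReal_pos.2 hε)) (min_le_left _ _)⟩
  let Q : FormalMultilinearSeries ℂ E ℂ := fun n => ((n : ℂ)⁻¹) • (P.unshift 0 n)
  have hQr : r ≤ Q.radius := by
    refine hP.r_le.trans ?_
    rw [← P.radius_unshift 0]
    refine FormalMultilinearSeries.radius_le_of_le fun {n} => ?_
    simp only [Q]
    rw [norm_smul]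
    refine mul_le_of_le_one_left (norm_nonneg _) ?_
    rw [norm_inv, Complex.norm_natCast]
    exact Nat.cast_inv_le_one n
  have key : HasFPowerSeriesOnBall (fun y => f y - f x) Q x r := by
    refine ⟨hQr, hr, fun {y} hy => ?_⟩
    have hyε : ‖y‖ < ε := by
      have h1 : y ∈ Metric.eball (0 : E) (ENNReal.ofReal ε) := Metric.eball_subset_eball hrε hy
      rw [Metric.eball_ofReal] at h1
      simpa using h1
    have hsm : ∀ t : ℝ, t ∈ Set.Icc (0:ℝ) 1 → ‖(t : ℂ) • y‖ ≤ ‖y‖ := by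
      intro t ht
      rw [norm_smul, Complex.norm_real, Real.norm_of_nonneg ht.1]
      exact mul_le_of_le_one_left (norm_nonneg _) ht.2
    let c : ℕ → ℂ := fun n => P n (fun _ => y) y
    have hder : ∀ t ∈ Set.uIcc (0:ℝ) 1,
        HasDerivAt (fun t : ℝ => f (x + (t : ℂ) • y)) (ω (x + (t : ℂ) • y) y) t := by
      intro t ht
      rw [Set.uIcc_of_le zero_le_one] at ht
      have h1 : HasFDerivAt f (ω (x + (t : ℂ) • y)) (x + (t : ℂ) • y) := by
        apply hball
        simpa using (hsm t ht).trans_lt hyε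
      have h2 : HasDerivAt (fun t : ℂ => x + t • y) y (t : ℂ) := by
        simpa using ((hasDerivAt_id (t : ℂ)).smul_const y).const_add x
      exact (h1.comp_hasDerivAt (t : ℂ) h2).comp_ofReal
    have hmem : ∀ t : ℝ, t ∈ Set.Icc (0:ℝ) 1 → (t : ℂ) • y ∈ Metric.eball (0 : E) r := by
      intro t ht
      rw [Metric.mem_eball, edist_zero_right] at hy ⊢
      refine lt_of_le_of_lt ?_ hy
      rw [enorm_le_iff_norm_le]
      exact hsm t ht
    have hsum : ∀ t : ℝ, t ∈ Set.Icc (0:ℝ) 1 →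
        HasSum (fun n => c n * (t : ℂ) ^ n) (ω (x + (t : ℂ) • y) y) := by
      intro t ht
      have hty := hmem t ht
      have h1 := (hP.hasSum hty).mapL (ContinuousLinearMap.apply ℂ ℂ y)
      suffices hfe : (fun n => c n * (t : ℂ) ^ n) =
          fun n => ContinuousLinearMap.apply ℂ ℂ y (P n fun _ => (t : ℂ) • y) by
        rw [hfe]; exact h1
      funext n
      change P n (fun _ => y) y * (t : ℂ) ^ n = P n (fun _ => (t : ℂ) • y) y
      rw [ContinuousMultilinearMap.map_smul_univ (P n) (fun _ => (t : ℂ)) (fun _ => y)]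
      simp [mul_comm]
    have hsn : Summable fun n => ‖c n‖ := by
      have h1 : Summable fun n => ‖P n fun _ => y‖ := 
        P.summable_norm_apply (Metric.eball_subset_eball hP.r_le hy)
      refine Summable.of_nonneg_of_le (fun _ => norm_nonneg _) (fun n => ?_) (h1.mul_right ‖y‖)
      exact (P n fun _ => y).le_opNorm y
    have hint : IntervalIntegrable (fun t : ℝ => ω (x + (t : ℂ) • y) y)
        MeasureTheory.volume 0 1 := by
      apply ContinuousOn.intervalIntegrable
      rw [Set.uIcc_of_le zero_le_one]
      have hc : ContinuousOn ω (Metric.eball x r) := hP.continuousOn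
      have hc2 : ContinuousOn (fun t : ℝ => ω (x + (t : ℂ) • y)) (Set.Icc 0 1) := by
        refine hc.comp (by fun_prop) fun t ht => ?_
        have := hmem t ht
        rw [Metric.mem_eball, edist_zero_right] at this
        rw [Metric.mem_eball, edist_eq_enorm_sub]
        simpa using this
      exact hc2.clm_apply continuousOn_const
    have hftc := intervalIntegral.integral_eq_sub_of_hasDerivAt hder hint
    have hmain : HasSum (fun n => ∫ t in (0:ℝ)..1, c n * (t : ℂ) ^ n)
        (∫ t in (0:ℝ)..1, ω (x + (t : ℂ) • y) y) := by
      refine intervalIntegral.hasSum_integral_of_dominated_convergence (fun n _ => ‖c n‖)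
        (fun n => ?_) (fun n => ?_) ?_ ?_ ?_
      · exact Continuous.aestronglyMeasurable (by fun_prop)
      · refine Filter.Eventually.of_forall fun t ht => ?_
        rw [Set.uIoc_of_le zero_le_one] at ht
        rw [norm_mul, norm_pow, Complex.norm_real, Real.norm_of_nonneg ht.1.le]
        exact mul_le_of_le_one_right (norm_nonneg _) (pow_le_one₀ ht.1.le ht.2)
      · exact Filter.Eventually.of_forall fun t ht => hsn
      · exact intervalIntegrable_const
      · refine Filter.Eventually.of_forall fun t ht => ?_
        rw [Set.uIoc_of_le zero_le_one] at ht
        exact hsum t ⟨ht.1.le, ht.2⟩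
    rw [hftc] at hmain
    have hcoef : ∀ n : ℕ, (∫ t in (0:ℝ)..1, c n * (t : ℂ) ^ n) = Q (n + 1) (fun _ => y) := by
      intro n
      have h1 : (∫ t in (0:ℝ)..1, (t : ℂ) ^ n) = ((n : ℂ) + 1)⁻¹ := by
        have h2 := integral_pow (a := 0) (b := 1) n
        have h3 : (∫ t in (0:ℝ)..1, (t : ℂ) ^ n) = ((∫ t in (0:ℝ)..1, t ^ n : ℝ) : ℂ) := by
          rw [← intervalIntegral.integral_ofReal]
          simp
        rw [h3, h2]
        simp
      rw [intervalIntegral.integral_const_mul, h1]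
      simp only [Q, c, smul_apply, FormalMultilinearSeries.unshift]
      simp [mul_comm]
      exact Or.inl rfl
    simp only [hcoef] at hmain
    have hQ0 : Q 0 (fun _ => y) = 0 := by simp [Q]
    rw [← hasSum_nat_add_iff' 1]
    simpa [hQ0] using hmain
  have := key.analyticAt.add (analyticAt_const (v := f x))
  refine this.congr (Filter.Eventually.of_forall fun y => ?_)
  simp

theorem pdx_of_hasFDerivAt {f : ℂ × ℂ → ℂ} {L : ℂ × ℂ →L[ℂ] ℂ} {z : ℂ × ℂ}
    (h : HasFDerivAt f L z) : pdx f z = L (1, 0) := by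
  have h2 : HasDerivAt (fun x : ℂ => (x, z.2)) ((1 : ℂ), (0 : ℂ)) z.1 :=
    (hasDerivAt_id z.1).prodMk (hasDerivAt_const z.1 z.2)
  exact (HasFDerivAt.comp_hasDerivAt (f := fun x : ℂ => (x, z.2)) z.1 h h2).deriv

theorem pdy_of_hasFDerivAt {f : ℂ × ℂ → ℂ} {L : ℂ × ℂ →L[ℂ] ℂ} {z : ℂ × ℂ}
    (h : HasFDerivAt f L z) : pdy f z = L (0, 1) := by
  have h2 : HasDerivAt (fun y : ℂ => (z.1, y)) ((0 : ℂ), (1 : ℂ)) z.2 :=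
    (hasDerivAt_const z.2 z.1).prodMk (hasDerivAt_id z.2)
  exact (HasFDerivAt.comp_hasDerivAt (f := fun y : ℂ => (z.1, y)) z.2 h h2).deriv

open Topology

theorem pdx_ev {f : ℂ × ℂ → ℂ} {z : ℂ × ℂ} (h : AnalyticAt ℂ f z) :
    pdx f =ᶠ[𝓝 z] fun w => fderiv ℂ f w (1, 0) := by
  filter_upwards [h.eventually_analyticAt] with w hw
  exact pdx_of_hasFDerivAt hw.differentiableAt.hasFDerivAt

theorem pdy_ev {f : ℂ × ℂ → ℂ} {z : ℂ × ℂ} (h : AnalyticAt ℂ f z) :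
    pdy f =ᶠ[𝓝 z] fun w => fderiv ℂ f w (0, 1) := by
  filter_upwards [h.eventually_analyticAt] with w hw
  exact pdy_of_hasFDerivAt hw.differentiableAt.hasFDerivAt

theorem pdx_congr {f g : ℂ × ℂ → ℂ} {z : ℂ × ℂ} (h : f =ᶠ[𝓝 z] g) : pdx f z = pdx g z := by
  have hc : Filter.Tendsto (fun x : ℂ => (x, z.2)) (𝓝 z.1) (𝓝 z) :=
    (by fun_prop : Continuous (fun x : ℂ => (x, z.2))).tendsto z.1
  exact Filter.EventuallyEq.deriv_eq (hc.eventually h)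

theorem pdy_congr {f g : ℂ × ℂ → ℂ} {z : ℂ × ℂ} (h : f =ᶠ[𝓝 z] g) : pdy f z = pdy g z := by
  have hc : Filter.Tendsto (fun y : ℂ => (z.1, y)) (𝓝 z.2) (𝓝 z) :=
    (by fun_prop : Continuous (fun y : ℂ => (z.1, y))).tendsto z.2
  exact Filter.EventuallyEq.deriv_eq (hc.eventually h)

theorem analyticAt_pdx {f : ℂ × ℂ → ℂ} {z : ℂ × ℂ} (h : AnalyticAt ℂ f z) :
    AnalyticAt ℂ (pdx f) z :=
  (((ContinuousLinearMap.apply ℂ ℂ ((1 : ℂ), (0 : ℂ))).analyticAt _).comp h.fderiv).congr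
    (pdx_ev h).symm

theorem analyticAt_pdy {f : ℂ × ℂ → ℂ} {z : ℂ × ℂ} (h : AnalyticAt ℂ f z) :
    AnalyticAt ℂ (pdy f) z :=
  (((ContinuousLinearMap.apply ℂ ℂ ((0 : ℂ), (1 : ℂ))).analyticAt _).comp h.fderiv).congr
    (pdy_ev h).symm

theorem pdx_mul {f g : ℂ × ℂ → ℂ} {z : ℂ × ℂ} (hf : AnalyticAt ℂ f z) (hg : AnalyticAt ℂ g z) :
    pdx (fun w => f w * g w) z = pdx f z * g z + f z * pdx g z := by
  have h1 := hf.differentiableAt.hasFDerivAt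
  have h2 := hg.differentiableAt.hasFDerivAt
  rw [pdx_of_hasFDerivAt h1, pdx_of_hasFDerivAt h2, pdx_of_hasFDerivAt (f := fun w => f w * g w) (h1.mul h2)]
  simp
  ring

theorem pdy_mul {f g : ℂ × ℂ → ℂ} {z : ℂ × ℂ} (hf : AnalyticAt ℂ f z) (hg : AnalyticAt ℂ g z) :
    pdy (fun w => f w * g w) z = pdy f z * g z + f z * pdy g z := by
  have h1 := hf.differentiableAt.hasFDerivAt
  have h2 := hg.differentiableAt.hasFDerivAt
  rw [pdy_of_hasFDerivAt h1, pdy_of_hasFDerivAt h2, pdy_of_hasFDerivAt (f := fun w => f w * g w) (h1.mul h2)]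
  simp
  ring

theorem pdx_neg {f : ℂ × ℂ → ℂ} {z : ℂ × ℂ} : pdx (fun w => - f w) z = - pdx f z := by
  simp only [pdx, deriv.fun_neg]

theorem pdy_neg {f : ℂ × ℂ → ℂ} {z : ℂ × ℂ} : pdy (fun w => - f w) z = - pdy f z := by
  simp only [pdy, deriv.fun_neg]

theorem pdx_neg_sub {f g : ℂ × ℂ → ℂ} {z : ℂ × ℂ} (hf : AnalyticAt ℂ f z)
    (hg : AnalyticAt ℂ g z) : pdx (fun w => - f w - g w) z = - pdx f z - pdx g z := by
  have h1 := hf.differentiableAt.hasFDerivAt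
  have h2 := hg.differentiableAt.hasFDerivAt
  rw [pdx_of_hasFDerivAt h1, pdx_of_hasFDerivAt h2, pdx_of_hasFDerivAt (f := fun w => - f w - g w) (h1.neg.sub h2)]
  simp

theorem pdy_neg_sub {f g : ℂ × ℂ → ℂ} {z : ℂ × ℂ} (hf : AnalyticAt ℂ f z)
    (hg : AnalyticAt ℂ g z) : pdy (fun w => - f w - g w) z = - pdy f z - pdy g z := by
  have h1 := hf.differentiableAt.hasFDerivAt
  have h2 := hg.differentiableAt.hasFDerivAt
  rw [pdy_of_hasFDerivAt h1, pdy_of_hasFDerivAt h2, pdy_of_hasFDerivAt (f := fun w => - f w - g w) (h1.neg.sub h2)]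
  simp

theorem pd_symm {f : ℂ × ℂ → ℂ} {z : ℂ × ℂ} (h : AnalyticAt ℂ f z) :
    pdx (pdy f) z = pdy (pdx f) z := by
  have hs : IsSymmSndFDerivAt ℂ f z := h.contDiffAt.isSymmSndFDerivAt_of_omega
  have hd : HasFDerivAt (fderiv ℂ f) (fderiv ℂ (fderiv ℂ f) z) z :=
    h.fderiv.differentiableAt.hasFDerivAt
  rw [pdx_congr (pdy_ev h), pdy_congr (pdx_ev h),
    pdx_of_hasFDerivAt (hd.clm_apply (hasFDerivAt_const _ _)),
    pdy_of_hasFDerivAt (hd.clm_apply (hasFDerivAt_const _ _))]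
  simpa using hs (1, 0) (0, 1)

/-- The 1-form `a dx + b dy` as a field of continuous linear maps. -/
def formOf (a b : ℂ × ℂ → ℂ) (z : ℂ × ℂ) : ℂ × ℂ →L[ℂ] ℂ :=
  a z • ContinuousLinearMap.fst ℂ ℂ ℂ + b z • ContinuousLinearMap.snd ℂ ℂ ℂ

theorem poincare_ball {a b : ℂ × ℂ → ℂ} {c : ℂ × ℂ} {r : ℝ}
    (ha : AnalyticOnNhd ℂ a (Metric.ball c r)) (hb : AnalyticOnNhd ℂ b (Metric.ball c r))
    (hc : ∀ z ∈ Metric.ball c r, pdx b z = pdy a z) :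
    ∃ F : ℂ × ℂ → ℂ, AnalyticOnNhd ℂ F (Metric.ball c r) ∧
      ∀ z ∈ Metric.ball c r, pdx F z = a z ∧ pdy F z = b z := by
  have hω : AnalyticOnNhd ℂ (formOf a b) (Metric.ball c r) := fun z hz =>
    ((ha z hz).smul analyticAt_const).add ((hb z hz).smul analyticAt_const)
  have hd : ∀ z ∈ Metric.ball c r, HasFDerivAt (𝕜 := ℂ) (formOf a b)
      ((fderiv ℂ a z).smulRight (ContinuousLinearMap.fst ℂ ℂ ℂ) +
        (fderiv ℂ b z).smulRight (ContinuousLinearMap.snd ℂ ℂ ℂ)) z := fun z hz =>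
    HasFDerivAt.add
      ((ha z hz).differentiableAt.hasFDerivAt.smul_const (ContinuousLinearMap.fst ℂ ℂ ℂ))
      ((hb z hz).differentiableAt.hasFDerivAt.smul_const (ContinuousLinearMap.snd ℂ ℂ ℂ))
  obtain ⟨F, hF⟩ := (convex_ball c r).exists_forall_hasFDerivAt_of_fderiv_symmetric
    (ω := formOf a b) Metric.isOpen_ball
    (fun z hz => ((hd z hz).restrictScalars ℝ).differentiableAt.differentiableWithinAt)
    (by
      intro z hz u v
      rw [((hd z hz).restrictScalars ℝ).fderiv]
      have h1 := hc z hz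
      rw [pdx_of_hasFDerivAt (hb z hz).differentiableAt.hasFDerivAt,
        pdy_of_hasFDerivAt (ha z hz).differentiableAt.hasFDerivAt] at h1
      have hdec : ∀ (L : ℂ × ℂ →L[ℂ] ℂ) (u : ℂ × ℂ), L u = u.1 * L (1, 0) + u.2 * L (0, 1) := by
        intro L u
        have : u = u.1 • ((1 : ℂ), (0 : ℂ)) + u.2 • ((0 : ℂ), (1 : ℂ)) := by
          ext <;> simp
        conv_lhs => rw [this]
        rw [map_add, map_smul, map_smul]
        simp
      simp
      rw [hdec (fderiv ℂ a z) u, hdec (fderiv ℂ a z) v, hdec (fderiv ℂ b z) u,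
        hdec (fderiv ℂ b z) v, h1]
      ring)
  refine ⟨F, fun z hz => prim_analyticAt (hω z hz) ?_, fun z hz => ⟨?_, ?_⟩⟩
  · filter_upwards [Metric.isOpen_ball.mem_nhds hz] with y hy using hF y hy
  · rw [pdx_of_hasFDerivAt (hF z hz)]; simp [formOf]
  · rw [pdy_of_hasFDerivAt (hF z hz)]; simp [formOf]

/-- A regular 3-web is locally parallelizable (sent by a local biholomorphism `(h₁, h₂)` to the
parallel web `(dx, dy, −dx−dy)`) if and only if its Blaschke curvature
`κ = (∂_x q − ∂_y p)·dx∧dy` vanishes. -/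
theorem stmt11 (U : Set (ℂ × ℂ)) (hU : IsOpen U)
    (a₁ b₁ a₂ b₂ a₃ b₃ : ℂ × ℂ → ℂ)
    (ha₁ : AnalyticOnNhd ℂ a₁ U) (hb₁ : AnalyticOnNhd ℂ b₁ U)
    (ha₂ : AnalyticOnNhd ℂ a₂ U) (hb₂ : AnalyticOnNhd ℂ b₂ U)
    (ha₃ : AnalyticOnNhd ℂ a₃ U) (hb₃ : AnalyticOnNhd ℂ b₃ U)
    (hnv₁ : ∀ z ∈ U, (a₁ z, b₁ z) ≠ (0, 0))
    (hnv₂ : ∀ z ∈ U, (a₂ z, b₂ z) ≠ (0, 0))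
    (hnv₃ : ∀ z ∈ U, (a₃ z, b₃ z) ≠ (0, 0))
    (h12 : ∀ z ∈ U, a₁ z * b₂ z - a₂ z * b₁ z ≠ 0)
    (h23 : ∀ z ∈ U, a₂ z * b₃ z - a₃ z * b₂ z ≠ 0)
    (h31 : ∀ z ∈ U, a₃ z * b₁ z - a₁ z * b₃ z ≠ 0)
    (hsum : ∀ z ∈ U, a₁ z + a₂ z + a₃ z = 0 ∧ b₁ z + b₂ z + b₃ z = 0)
    (p q : ℂ × ℂ → ℂ)
    (hpq : ∀ z ∈ U,
        pdx b₁ z - pdy a₁ z = p z * b₁ z - q z * a₁ z ∧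
        pdx b₂ z - pdy a₂ z = p z * b₂ z - q z * a₂ z ∧
        pdx b₃ z - pdy a₃ z = p z * b₃ z - q z * a₃ z) :
    (∀ z ∈ U, pdx q z - pdy p z = 0) ↔
    (∀ z ∈ U, ∃ V : Set (ℂ × ℂ), IsOpen V ∧ z ∈ V ∧ V ⊆ U ∧
      ∃ h₁ h₂ g₁ g₂ g₃ : ℂ × ℂ → ℂ,
        AnalyticOnNhd ℂ h₁ V ∧ AnalyticOnNhd ℂ h₂ V ∧
        AnalyticOnNhd ℂ g₁ V ∧ AnalyticOnNhd ℂ g₂ V ∧ AnalyticOnNhd ℂ g₃ V ∧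
        (∀ w ∈ V, g₁ w ≠ 0 ∧ g₂ w ≠ 0 ∧ g₃ w ≠ 0) ∧
        (∀ w ∈ V,
          pdx h₁ w = g₁ w * a₁ w ∧ pdy h₁ w = g₁ w * b₁ w ∧
          pdx h₂ w = g₂ w * a₂ w ∧ pdy h₂ w = g₂ w * b₂ w ∧
          pdx (fun u => -h₁ u - h₂ u) w = g₃ w * a₃ w ∧
          pdy (fun u => -h₁ u - h₂ u) w = g₃ w * b₃ w)) := by
  have hpe : ∀ z ∈ U, p z = ((pdx b₂ z - pdy a₂ z) * a₁ z - (pdx b₁ z - pdy a₁ z) * a₂ z) /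
      (a₁ z * b₂ z - a₂ z * b₁ z) := by
    intro z hz
    rw [eq_div_iff (h12 z hz), (hpq z hz).1, (hpq z hz).2.1]
    ring
  have hqe : ∀ z ∈ U, q z = ((pdx b₂ z - pdy a₂ z) * b₁ z - (pdx b₁ z - pdy a₁ z) * b₂ z) /
      (a₁ z * b₂ z - a₂ z * b₁ z) := by
    intro z hz
    rw [eq_div_iff (h12 z hz), (hpq z hz).1, (hpq z hz).2.1]
    ring
  have hpa : AnalyticOnNhd ℂ p U := by
    intro z hz
    refine AnalyticAt.congr (f := fun z => ((pdx b₂ z - pdy a₂ z) * a₁ z -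
      (pdx b₁ z - pdy a₁ z) * a₂ z) / (a₁ z * b₂ z - a₂ z * b₁ z)) ?_ ?_
    · have e1 := analyticAt_pdx (hb₁ z hz)
      have e2 := analyticAt_pdx (hb₂ z hz)
      have e3 := analyticAt_pdy (ha₁ z hz)
      have e4 := analyticAt_pdy (ha₂ z hz)
      exact (((e2.sub e4).mul (ha₁ z hz)).sub ((e1.sub e3).mul (ha₂ z hz))).div
        (((ha₁ z hz).mul (hb₂ z hz)).sub ((ha₂ z hz).mul (hb₁ z hz))) (h12 z hz)
    · filter_upwards [hU.mem_nhds hz] with w hw using (hpe w hw).symm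
  have hqa : AnalyticOnNhd ℂ q U := by
    intro z hz
    refine AnalyticAt.congr (f := fun z => ((pdx b₂ z - pdy a₂ z) * b₁ z -
      (pdx b₁ z - pdy a₁ z) * b₂ z) / (a₁ z * b₂ z - a₂ z * b₁ z)) ?_ ?_
    · have e1 := analyticAt_pdx (hb₁ z hz)
      have e2 := analyticAt_pdx (hb₂ z hz)
      have e3 := analyticAt_pdy (ha₁ z hz)
      have e4 := analyticAt_pdy (ha₂ z hz)
      exact (((e2.sub e4).mul (hb₁ z hz)).sub ((e1.sub e3).mul (hb₂ z hz))).div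
        (((ha₁ z hz).mul (hb₂ z hz)).sub ((ha₂ z hz).mul (hb₁ z hz))) (h12 z hz)
    · filter_upwards [hU.mem_nhds hz] with w hw using (hqe w hw).symm
  constructor
  · intro hk z hz
    obtain ⟨r, hr, hrU⟩ := Metric.isOpen_iff.1 hU z hz
    obtain ⟨F, hFa, hF⟩ := poincare_ball (hpa.mono hrU) (hqa.mono hrU)
      (fun w hw => sub_eq_zero.1 (hk w (hrU hw)))
    let g : ℂ × ℂ → ℂ := fun w => Complex.exp (-F w)
    have hga : AnalyticOnNhd ℂ g (Metric.ball z r) := fun w hw => (hFa w hw).neg.cexp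
    have hgx : ∀ w ∈ Metric.ball z r, pdx g w = - g w * p w := by
      intro w hw
      have h1 := (hFa w hw).differentiableAt.hasFDerivAt
      rw [← (hF w hw).1, pdx_of_hasFDerivAt h1, pdx_of_hasFDerivAt (f := g) h1.neg.cexp]
      simp [g]
    have hgy : ∀ w ∈ Metric.ball z r, pdy g w = - g w * q w := by
      intro w hw
      have h1 := (hFa w hw).differentiableAt.hasFDerivAt
      rw [← (hF w hw).2, pdy_of_hasFDerivAt h1, pdy_of_hasFDerivAt (f := g) h1.neg.cexp]
      simp [g]
    obtain ⟨h₁, hh₁, hd₁⟩ := poincare_ball (a := fun w => g w * a₁ w) (b := fun w => g w * b₁ w)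
      (c := z) (r := r)
      (fun w hw => (hga w hw).mul (ha₁ w (hrU hw))) (fun w hw => (hga w hw).mul (hb₁ w (hrU hw)))
      (by
        intro w hw
        rw [pdx_mul (hga w hw) (hb₁ w (hrU hw)), pdy_mul (hga w hw) (ha₁ w (hrU hw)),
          hgx w hw, hgy w hw]
        linear_combination g w * (hpq w (hrU hw)).1)
    obtain ⟨h₂, hh₂, hd₂⟩ := poincare_ball (a := fun w => g w * a₂ w) (b := fun w => g w * b₂ w)
      (c := z) (r := r)
      (fun w hw => (hga w hw).mul (ha₂ w (hrU hw))) (fun w hw => (hga w hw).mul (hb₂ w (hrU hw)))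
      (by
        intro w hw
        rw [pdx_mul (hga w hw) (hb₂ w (hrU hw)), pdy_mul (hga w hw) (ha₂ w (hrU hw)),
          hgx w hw, hgy w hw]
        linear_combination g w * (hpq w (hrU hw)).2.1)
    refine ⟨Metric.ball z r, Metric.isOpen_ball, Metric.mem_ball_self hr, hrU, h₁, h₂, g, g, g,
      hh₁, hh₂, hga, hga, hga, fun w hw => ⟨Complex.exp_ne_zero _, Complex.exp_ne_zero _,
        Complex.exp_ne_zero _⟩, fun w hw => ⟨(hd₁ w hw).1, (hd₁ w hw).2, (hd₂ w hw).1,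
        (hd₂ w hw).2, ?_, ?_⟩⟩
    · rw [pdx_neg_sub (hh₁ w hw) (hh₂ w hw), (hd₁ w hw).1, (hd₂ w hw).1]
      linear_combination -g w * (hsum w (hrU hw)).1
    · rw [pdy_neg_sub (hh₁ w hw) (hh₂ w hw), (hd₁ w hw).2, (hd₂ w hw).2]
      linear_combination -g w * (hsum w (hrU hw)).2
  · intro H z hz
    obtain ⟨V, hV, hzV, hVU, h₁, h₂, g₁, g₂, g₃, hh₁, hh₂, hg₁, hg₂, hg₃, hne, hd⟩ := H z hz
    have hg12 : ∀ w ∈ V, g₂ w = g₁ w := by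
      intro w hw
      obtain ⟨e1, e2, e3, e4, e5, e6⟩ := hd w hw
      rw [pdx_neg_sub (hh₁ w hw) (hh₂ w hw), e1, e3] at e5
      rw [pdy_neg_sub (hh₁ w hw) (hh₂ w hw), e2, e4] at e6
      obtain ⟨s1, s2⟩ := hsum w (hVU hw)
      have hD := h12 w (hVU hw)
      have k1 : (g₁ w - g₃ w) * (a₁ w * b₂ w - a₂ w * b₁ w) = 0 := by
        linear_combination (-b₂ w) * e5 + a₂ w * e6 - g₃ w * b₂ w * s1 + g₃ w * a₂ w * s2
      have k2 : (g₂ w - g₃ w) * (a₁ w * b₂ w - a₂ w * b₁ w) = 0 := by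
        linear_combination (b₁ w) * e5 - a₁ w * e6 + g₃ w * b₁ w * s1 - g₃ w * a₁ w * s2
      have k1' := (mul_eq_zero.1 k1).resolve_right hD
      have k2' := (mul_eq_zero.1 k2).resolve_right hD
      linear_combination k2' - k1'
    have hcl₁ : ∀ w ∈ V, pdx (fun w => g₁ w * b₁ w) w = pdy (fun w => g₁ w * a₁ w) w := by
      intro w hw
      rw [← pdx_congr (f := pdy h₁) (by
          filter_upwards [hV.mem_nhds hw] with u hu using (hd u hu).2.1),
        ← pdy_congr (f := pdx h₁) (by
          filter_upwards [hV.mem_nhds hw] with u hu using (hd u hu).1)]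
      exact pd_symm (hh₁ w hw)
    have hcl₂ : ∀ w ∈ V, pdx (fun w => g₁ w * b₂ w) w = pdy (fun w => g₁ w * a₂ w) w := by
      intro w hw
      rw [← pdx_congr (f := pdy h₂) (by
          filter_upwards [hV.mem_nhds hw] with u hu
          rw [(hd u hu).2.2.2.1, hg12 u hu]),
        ← pdy_congr (f := pdx h₂) (by
          filter_upwards [hV.mem_nhds hw] with u hu
          rw [(hd u hu).2.2.1, hg12 u hu])]
      exact pd_symm (hh₂ w hw)
    have hdg : ∀ w ∈ V, pdx g₁ w = -(g₁ w * p w) ∧ pdy g₁ w = -(g₁ w * q w) := by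
      intro w hw
      have c1 := hcl₁ w hw
      have c2 := hcl₂ w hw
      have hu := hVU hw
      rw [pdx_mul (hg₁ w hw) (hb₁ w hu), pdy_mul (hg₁ w hw) (ha₁ w hu)] at c1
      rw [pdx_mul (hg₁ w hw) (hb₂ w hu), pdy_mul (hg₁ w hw) (ha₂ w hu)] at c2
      obtain ⟨q1, q2, -⟩ := hpq w hu
      have hD := h12 w hu
      have d1 : (pdx g₁ w + g₁ w * p w) * b₁ w = (pdy g₁ w + g₁ w * q w) * a₁ w := by
        linear_combination c1 - g₁ w * q1
      have d2 : (pdx g₁ w + g₁ w * p w) * b₂ w = (pdy g₁ w + g₁ w * q w) * a₂ w := by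
        linear_combination c2 - g₁ w * q2
      have k1 : (pdx g₁ w + g₁ w * p w) * (a₁ w * b₂ w - a₂ w * b₁ w) = 0 := by
        linear_combination a₁ w * d2 - a₂ w * d1
      have k2 : (pdy g₁ w + g₁ w * q w) * (a₁ w * b₂ w - a₂ w * b₁ w) = 0 := by
        linear_combination b₁ w * d2 - b₂ w * d1
      exact ⟨eq_neg_of_add_eq_zero_left ((mul_eq_zero.1 k1).resolve_right hD),
        eq_neg_of_add_eq_zero_left ((mul_eq_zero.1 k2).resolve_right hD)⟩
    have hsy := pd_symm (hg₁ z hzV)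
    rw [pdx_congr (g := fun w => -(g₁ w * q w)) (by
          filter_upwards [hV.mem_nhds hzV] with u hu using (hdg u hu).2),
        pdy_congr (g := fun w => -(g₁ w * p w)) (by
          filter_upwards [hV.mem_nhds hzV] with u hu using (hdg u hu).1),
        pdx_neg, pdy_neg, pdx_mul (hg₁ z hzV) (hqa z hz), pdy_mul (hg₁ z hzV) (hpa z hz),
        (hdg z hzV).1, (hdg z hzV).2] at hsy
    have hfin : g₁ z * (pdx q z - pdy p z) = 0 := by linear_combination -hsy
    exact (mul_eq_zero.1 hfin).resolve_left (hne z hzV).1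
end
end

section
/- The following are equivalent: (i) (a1,a2,a3,a4) = (0,0,0,4); (ii) for every nonempty connected open V ⊂ ℂ² and every holomorphic s : V → ℂ with P_𝐚(x1, x2, s(x1,x2)) = 0 on V and such that the functions A(x1,x2) = 2x1 + x2·s(x1,x2) − a1 and B(x1,x2) = 2x2 + x1·s(x1,x2) − a2 vanish nowhere on V, the Blaschke curvature function K := ((∂_{x1}∂_{x2}A)·A − (∂_{x1}A)·(∂_{x2}A))/A² − ((∂_{x1}∂_{x2}B)·B − (∂_{x1}B)·(∂_{x2}B))/B² vanishes identically on V. (This is the statement that the 3-web (ker dx1, ker dx2, ker dx3) on S_𝐚 is locally parallelizable iff 𝐚 = (0,0,0,4).) -/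
noncomputable section

open Filter Topology

lemma aux_slice1 {Q : ℂ × ℂ → Prop} {z : ℂ × ℂ} (h : ∀ᶠ w in 𝓝 z, Q w) :
    ∀ᶠ x in 𝓝 z.1, Q (x, z.2) := by
  have : Tendsto (fun x : ℂ => (x, z.2)) (𝓝 z.1) (𝓝 z) := by
    have h : ContinuousAt (fun x : ℂ => (x, z.2)) z.1 := by fun_prop
    exact h
  exact this.eventually h

lemma aux_slice2 {Q : ℂ × ℂ → Prop} {z : ℂ × ℂ} (h : ∀ᶠ w in 𝓝 z, Q w) :
    ∀ᶠ y in 𝓝 z.2, Q (z.1, y) := by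
  have : Tendsto (fun y : ℂ => (z.1, y)) (𝓝 z.2) (𝓝 z) := by
    have h : ContinuousAt (fun y : ℂ => (z.1, y)) z.2 := by fun_prop
    exact h
  exact this.eventually h

lemma aux_dx {s : ℂ × ℂ → ℂ} {z : ℂ × ℂ} (h : DifferentiableAt ℂ s z) :
    HasDerivAt (fun x => s (x, z.2)) (pdx s z) z.1 := by
  have : DifferentiableAt ℂ (fun x => s (x, z.2)) z.1 := by
    have h' : DifferentiableAt ℂ s (z.1, z.2) := h
    exact DifferentiableAt.comp z.1 (g := s) (f := fun x => (x, z.2)) h' (by fun_prop)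
  exact this.hasDerivAt

lemma aux_dy {s : ℂ × ℂ → ℂ} {z : ℂ × ℂ} (h : DifferentiableAt ℂ s z) :
    HasDerivAt (fun y => s (z.1, y)) (pdy s z) z.2 := by
  have : DifferentiableAt ℂ (fun y => s (z.1, y)) z.2 := by
    have h' : DifferentiableAt ℂ s (z.1, z.2) := h
    exact DifferentiableAt.comp z.2 (g := s) (f := fun y => (z.1, y)) h' (by fun_prop)
  exact this.hasDerivAt

lemma aux_pdy_fderiv {s : ℂ × ℂ → ℂ} {z : ℂ × ℂ} (h : DifferentiableAt ℂ s z) :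
    pdy s z = fderiv ℂ s z (0, 1) := by
  have h1 : HasFDerivAt s (fderiv ℂ s z) (z.1, z.2) := h.hasFDerivAt
  have h2 : HasDerivAt (fun y : ℂ => (z.1, y)) ((0 : ℂ), (1 : ℂ)) z.2 :=
    (hasDerivAt_const _ _).prodMk (hasDerivAt_id _)
  have h3 := HasFDerivAt.comp_hasDerivAt z.2 (l := s) (f := fun y : ℂ => (z.1, y)) h1 h2
  exact h3.deriv

lemma aux_pdy_diff {s : ℂ × ℂ → ℂ} {z : ℂ × ℂ} (h : AnalyticAt ℂ s z) :
    DifferentiableAt ℂ (pdy s) z := by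
  have h1 : DifferentiableAt ℂ (fun w => fderiv ℂ s w (0, 1)) z :=
    h.fderiv.differentiableAt.clm_apply (differentiableAt_const _)
  refine h1.congr_of_eventuallyEq ?_
  filter_upwards [h.eventually_analyticAt] with w hw
  exact aux_pdy_fderiv hw.differentiableAt

lemma aux_calc (a₁ a₂ a₃ a₄ : ℂ) (s : ℂ × ℂ → ℂ) (z : ℂ × ℂ)
    (hs : AnalyticAt ℂ s z)
    (hP : ∀ᶠ z in 𝓝 z, z.1 ^ 2 + z.2 ^ 2 + (s z) ^ 2 + z.1 * z.2 * s z
          - a₁ * z.1 - a₂ * z.2 - a₃ * s z - a₄ = 0) :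
    ∃ p q r : ℂ,
      (2 * s z + z.1 * z.2 - a₃) * p = - (2 * z.1 + z.2 * s z - a₁) ∧
      (2 * s z + z.1 * z.2 - a₃) * q = - (2 * z.2 + z.1 * s z - a₂) ∧
      (2 * s z + z.1 * z.2 - a₃) * r = - (2 * p * q + z.2 * q + z.1 * p + s z) ∧
      HasDerivAt (fun x => s (x, z.2)) p z.1 ∧
      pdx (fun w => 2 * w.1 + w.2 * s w - a₁) z = 2 + z.2 * p ∧
      pdy (fun w => 2 * w.1 + w.2 * s w - a₁) z = s z + z.2 * q ∧
      pdx (pdy (fun w => 2 * w.1 + w.2 * s w - a₁)) z = p + z.2 * r ∧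
      pdx (fun w => 2 * w.2 + w.1 * s w - a₂) z = s z + z.1 * p ∧
      pdy (fun w => 2 * w.2 + w.1 * s w - a₂) z = 2 + z.1 * q ∧
      pdx (pdy (fun w => 2 * w.2 + w.1 * s w - a₂)) z = q + z.1 * r := by
  have hx := aux_dx hs.differentiableAt
  have hy : ∀ᶠ w in 𝓝 z, HasDerivAt (fun y => s (w.1, y)) (pdy s w) w.2 := by
    filter_upwards [hs.eventually_analyticAt] with w hw
    exact aux_dy hw.differentiableAt
  have hr := aux_dx (aux_pdy_diff hs)
  have hAy : ∀ᶠ w in 𝓝 z, pdy (fun w => 2 * w.1 + w.2 * s w - a₁) w = s w + w.2 * pdy s w := by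
    filter_upwards [hy] with w hw
    have := (((hasDerivAt_id w.2).mul hw).const_add (2 * w.1)).sub_const a₁
    refine HasDerivAt.deriv (this.congr_deriv ?_)
    simp
  have hBy : ∀ᶠ w in 𝓝 z, pdy (fun w => 2 * w.2 + w.1 * s w - a₂) w = 2 + w.1 * pdy s w := by
    filter_upwards [hy] with w hw
    have := ((((hasDerivAt_id w.2).const_mul 2)).add (hw.const_mul w.1)).sub_const a₂
    refine HasDerivAt.deriv (this.congr_deriv ?_)
    simp
  have hq : ∀ᶠ w in 𝓝 z, (2 * s w + w.1 * w.2 - a₃) * pdy s w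
      + (2 * w.2 + w.1 * s w - a₂) = 0 := by
    filter_upwards [hy, hP.eventually_nhds] with w hw hPw
    have h0 : HasDerivAt (fun y : ℂ => w.1 ^ 2 + y ^ 2 + (s (w.1, y)) ^ 2 + w.1 * y * s (w.1, y)
          - a₁ * w.1 - a₂ * y - a₃ * s (w.1, y) - a₄) 0 w.2 := by
      refine (hasDerivAt_const w.2 (0 : ℂ)).congr_of_eventuallyEq ?_
      exact aux_slice2 hPw
    have h1 := (((((((((hasDerivAt_id w.2).pow 2).const_add (w.1 ^ 2)).add (hw.pow 2)).add
      (((hasDerivAt_id w.2).const_mul w.1).mul hw)).sub_const (a₁ * w.1)).sub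
      ((hasDerivAt_id w.2).const_mul a₂)).sub (hw.const_mul a₃)).sub_const a₄)
    have h2 := h1.unique h0
    simp at h2
    linear_combination h2
  refine ⟨pdx s z, pdy s z, pdx (pdy s) z, ?_, ?_, ?_, hx, ?_, hAy.self_of_nhds, ?_, ?_,
    hBy.self_of_nhds, ?_⟩
  · have h0 : HasDerivAt (fun x : ℂ => x ^ 2 + z.2 ^ 2 + (s (x, z.2)) ^ 2 + x * z.2 * s (x, z.2)
          - a₁ * x - a₂ * z.2 - a₃ * s (x, z.2) - a₄) 0 z.1 := by
      refine (hasDerivAt_const z.1 (0 : ℂ)).congr_of_eventuallyEq ?_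
      exact aux_slice1 hP
    have h1 := (((((((((hasDerivAt_id z.1).pow 2).add_const (z.2 ^ 2)).add (hx.pow 2)).add
      (((hasDerivAt_id z.1).mul_const z.2).mul hx)).sub
      ((hasDerivAt_id z.1).const_mul a₁)).sub_const (a₂ * z.2)).sub (hx.const_mul a₃)).sub_const a₄)
    have h2 := h1.unique h0
    simp at h2
    linear_combination h2
  · linear_combination hq.self_of_nhds
  · have h0 : HasDerivAt (fun x : ℂ => (2 * s (x, z.2) + x * z.2 - a₃) * pdy s (x, z.2)
      + (2 * z.2 + x * s (x, z.2) - a₂)) 0 z.1 := by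
      refine (hasDerivAt_const z.1 (0 : ℂ)).congr_of_eventuallyEq ?_
      exact aux_slice1 hq
    have h1 := ((((hx.const_mul 2).add ((hasDerivAt_id z.1).mul_const z.2)).sub_const a₃).mul hr).add
      ((((hasDerivAt_id z.1).mul hx).const_add (2 * z.2)).sub_const a₂)
    have h2 := h1.unique h0
    simp at h2
    linear_combination h2
  · have := ((((hasDerivAt_id z.1).const_mul 2)).add (hx.const_mul z.2)).sub_const a₁
    refine HasDerivAt.deriv (this.congr_deriv ?_)
    simp
  · have h1 := hx.add (hr.const_mul z.2)
    exact (h1.congr_of_eventuallyEq (aux_slice1 hAy)).deriv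
  · have := (((hasDerivAt_id z.1).mul hx).const_add (2 * z.2)).sub_const a₂
    refine HasDerivAt.deriv (this.congr_deriv ?_)
    simp
  · have h1 := ((hasDerivAt_id z.1).mul hr).const_add 2
    have h2 := (h1.congr_of_eventuallyEq (aux_slice1 hBy)).deriv
    refine h2.trans ?_
    simp

lemma aux_sqrt (u : ℂ) : (u ^ ((1 : ℂ) / 2)) ^ 2 = u := by
  have := Complex.cpow_nat_inv_pow u (n := 2) (by norm_num)
  simpa using this

lemma aux_sec (a₁ a₂ a₃ a₄ x₀ y₀ z₀ : ℂ)
    (hP : x₀ ^ 2 + y₀ ^ 2 + z₀ ^ 2 + x₀ * y₀ * z₀ - a₁ * x₀ - a₂ * y₀ - a₃ * z₀ - a₄ = 0)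
    (hC : 2 * z₀ + x₀ * y₀ - a₃ ≠ 0) :
    ∃ s : ℂ × ℂ → ℂ, s (x₀, y₀) = z₀ ∧ AnalyticAt ℂ s (x₀, y₀) ∧
      ∀ z : ℂ × ℂ, z.1 ^ 2 + z.2 ^ 2 + (s z) ^ 2 + z.1 * z.2 * s z
          - a₁ * z.1 - a₂ * z.2 - a₃ * s z - a₄ = 0 := by
  set c := 2 * z₀ + x₀ * y₀ - a₃ with hc
  set D : ℂ × ℂ → ℂ := fun w => ((w.1 * w.2 - a₃) ^ 2
    - 4 * (w.1 ^ 2 + w.2 ^ 2 - a₁ * w.1 - a₂ * w.2 - a₄)) / c ^ 2 with hD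
  have hD0 : D (x₀, y₀) = 1 := by
    simp only [hD]
    rw [div_eq_one_iff_eq (pow_ne_zero 2 hC), hc]
    linear_combination (-4) * hP
  refine ⟨fun w => (a₃ - w.1 * w.2 + c * (D w) ^ ((1 : ℂ) / 2)) / 2, ?_, ?_, ?_⟩
  · simp only [hD0, Complex.one_cpow, hc]; ring
  · have hDa : AnalyticAt ℂ D (x₀, y₀) := by
      simp only [hD, div_eq_mul_inv]
      have f1 : AnalyticAt ℂ (fun w : ℂ × ℂ => w.1) (x₀, y₀) := analyticAt_fst
      have f2 : AnalyticAt ℂ (fun w : ℂ × ℂ => w.2) (x₀, y₀) := analyticAt_snd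
      fun_prop
    have h2 : AnalyticAt ℂ (fun w => (D w) ^ ((1 : ℂ) / 2)) (x₀, y₀) :=
      hDa.cpow analyticAt_const (by rw [hD0]; exact Complex.one_mem_slitPlane)
    simp only [div_eq_mul_inv] at h2 ⊢
    have f1 : AnalyticAt ℂ (fun w : ℂ × ℂ => w.1) (x₀, y₀) := analyticAt_fst
    have f2 : AnalyticAt ℂ (fun w : ℂ × ℂ => w.2) (x₀, y₀) := analyticAt_snd
    fun_prop
  · intro w
    have h := aux_sqrt (D w)
    have h' : c ^ 2 * D w = (w.1 * w.2 - a₃) ^ 2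
        - 4 * (w.1 ^ 2 + w.2 ^ 2 - a₁ * w.1 - a₂ * w.2 - a₄) := by
      simp only [hD]; field_simp
    linear_combination (c ^ 2 / 4) * h + h' / 4

lemma aux_root (a₁ a₂ a₃ a₄ σ : ℂ) (hσ : σ ^ 2 = 1) :
    ∃ Z : ℂ → ℂ, ContinuousAt Z 0 ∧ Z 0 = 2 * σ ∧ ∀ᶠ e in 𝓝 (0 : ℂ),
      (1 - 4 * e ^ 2) * (Z e) ^ 2 + (4 * a₃ * e ^ 2 - 2 * a₁ * e) * Z e
        + (a₁ ^ 2 * e ^ 2 - 4 + 4 * a₂ * e + 4 * a₄ * e ^ 2) = 0 := by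
  set D : ℂ → ℂ := fun e => ((4 * a₃ * e ^ 2 - 2 * a₁ * e) ^ 2
    - 4 * (1 - 4 * e ^ 2) * (a₁ ^ 2 * e ^ 2 - 4 + 4 * a₂ * e + 4 * a₄ * e ^ 2)) / 16 with hD
  have hD0 : D 0 = 1 := by simp only [hD]; norm_num
  have hDc : ContinuousAt D 0 := by simp only [hD]; fun_prop
  have h2 : ContinuousAt (fun e => (D e) ^ ((1 : ℂ) / 2)) 0 :=
    hDc.cpow continuousAt_const (by rw [hD0]; exact Complex.one_mem_slitPlane)
  have hne : ∀ᶠ e in 𝓝 (0 : ℂ), 1 - 4 * e ^ 2 ≠ 0 := by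
    have : ContinuousAt (fun e : ℂ => 1 - 4 * e ^ 2) 0 := by fun_prop
    exact this.eventually_ne (by norm_num)
  refine ⟨fun e => (-(4 * a₃ * e ^ 2 - 2 * a₁ * e) + σ * (4 * (D e) ^ ((1 : ℂ) / 2)))
    / (2 * (1 - 4 * e ^ 2)), ?_, ?_, ?_⟩
  · refine ContinuousAt.div ?_ (by fun_prop) (by norm_num)
    exact ContinuousAt.add (by fun_prop)
      (continuousAt_const.mul (continuousAt_const.mul h2))
  · simp only [hD0, Complex.one_cpow]; norm_num; ring
  · filter_upwards [hne] with e he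
    have h := aux_sqrt (D e)
    have h' : 16 * D e = (4 * a₃ * e ^ 2 - 2 * a₁ * e) ^ 2
      - 4 * (1 - 4 * e ^ 2) * (a₁ ^ 2 * e ^ 2 - 4 + 4 * a₂ * e + 4 * a₄ * e ^ 2) := by
      simp only [hD]; ring
    generalize (D e) ^ ((1 : ℂ) / 2) = δ at *
    generalize D e = d at *
    subst h
    set m := 1 - 4 * e ^ 2 with hm
    field_simp
    linear_combination (16 * δ ^ 2) * hσ + h'

def auxA (a₁ x y z : ℂ) : ℂ := 2 * x + y * z - a₁
def auxB (a₂ x y z : ℂ) : ℂ := 2 * y + x * z - a₂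
def auxC (a₃ x y z : ℂ) : ℂ := 2 * z + x * y - a₃
def auxp (a₁ a₃ x y z : ℂ) : ℂ := - auxA a₁ x y z / auxC a₃ x y z
def auxq (a₂ a₃ x y z : ℂ) : ℂ := - auxB a₂ x y z / auxC a₃ x y z
def auxr (a₁ a₂ a₃ x y z : ℂ) : ℂ :=
  - (2 * auxp a₁ a₃ x y z * auxq a₂ a₃ x y z + y * auxq a₂ a₃ x y z + x * auxp a₁ a₃ x y z + z)
    / auxC a₃ x y z
def auxN (a₁ a₂ a₃ x y z : ℂ) : ℂ :=
  ((auxp a₁ a₃ x y z + y * auxr a₁ a₂ a₃ x y z) * auxA a₁ x y z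
    - (2 + y * auxp a₁ a₃ x y z) * (z + y * auxq a₂ a₃ x y z)) * (auxB a₂ x y z) ^ 2
  - ((auxq a₂ a₃ x y z + x * auxr a₁ a₂ a₃ x y z) * auxB a₂ x y z
    - (z + x * auxp a₁ a₃ x y z) * (2 + x * auxq a₂ a₃ x y z)) * (auxA a₁ x y z) ^ 2

lemma auxN_cont (a₁ a₂ a₃ y x₀ : ℂ) (S : ℂ → ℂ) (hS : ContinuousAt S x₀)
    (hC : auxC a₃ x₀ y (S x₀) ≠ 0) : ContinuousAt (fun x => auxN a₁ a₂ a₃ x y (S x)) x₀ := by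
  have cA : ContinuousAt (fun x => auxA a₁ x y (S x)) x₀ := by unfold auxA; fun_prop
  have cB : ContinuousAt (fun x => auxB a₂ x y (S x)) x₀ := by unfold auxB; fun_prop
  have cC : ContinuousAt (fun x => auxC a₃ x y (S x)) x₀ := by unfold auxC; fun_prop
  have cp : ContinuousAt (fun x => auxp a₁ a₃ x y (S x)) x₀ := cA.neg.div cC hC
  have cq : ContinuousAt (fun x => auxq a₂ a₃ x y (S x)) x₀ := cB.neg.div cC hC
  have cr : ContinuousAt (fun x => auxr a₁ a₂ a₃ x y (S x)) x₀ := by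
    unfold auxr
    exact ContinuousAt.div (by fun_prop) cC hC
  unfold auxN
  fun_prop

def auxH (a₁ a₂ a₃ a₄ : ℂ) : Prop :=
  (∀ V : Set (ℂ × ℂ), IsOpen V → V.Nonempty → IsConnected V →
      ∀ s : ℂ × ℂ → ℂ, AnalyticOnNhd ℂ s V →
      (∀ z ∈ V, z.1 ^ 2 + z.2 ^ 2 + (s z) ^ 2 + z.1 * z.2 * s z
          - a₁ * z.1 - a₂ * z.2 - a₃ * s z - a₄ = 0) →
      (∀ z ∈ V, 2 * z.1 + z.2 * s z - a₁ ≠ 0) →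
      (∀ z ∈ V, 2 * z.2 + z.1 * s z - a₂ ≠ 0) →
      ∀ z ∈ V,
        (pdx (pdy (fun w => 2 * w.1 + w.2 * s w - a₁)) z
              * (2 * z.1 + z.2 * s z - a₁)
            - pdx (fun w => 2 * w.1 + w.2 * s w - a₁) z
              * pdy (fun w => 2 * w.1 + w.2 * s w - a₁) z)
          / (2 * z.1 + z.2 * s z - a₁) ^ 2
        - (pdx (pdy (fun w => 2 * w.2 + w.1 * s w - a₂)) z
              * (2 * z.2 + z.1 * s z - a₂)
            - pdx (fun w => 2 * w.2 + w.1 * s w - a₂) z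
              * pdy (fun w => 2 * w.2 + w.1 * s w - a₂) z)
          / (2 * z.2 + z.1 * s z - a₂) ^ 2 = 0)

lemma aux_N (a₁ a₂ a₃ a₄ : ℂ) (H : auxH a₁ a₂ a₃ a₄) (s : ℂ × ℂ → ℂ) (z : ℂ × ℂ)
    (hs : AnalyticAt ℂ s z)
    (hP : ∀ z : ℂ × ℂ, z.1 ^ 2 + z.2 ^ 2 + (s z) ^ 2 + z.1 * z.2 * s z
          - a₁ * z.1 - a₂ * z.2 - a₃ * s z - a₄ = 0)
    (hA : 2 * z.1 + z.2 * s z - a₁ ≠ 0) (hB : 2 * z.2 + z.1 * s z - a₂ ≠ 0) :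
    auxN a₁ a₂ a₃ z.1 z.2 (s z) = 0 := by
  have hsc := hs.continuousAt
  have eA : ∀ᶠ w in 𝓝 z, 2 * w.1 + w.2 * s w - a₁ ≠ 0 := by
    have : ContinuousAt (fun w : ℂ × ℂ => 2 * w.1 + w.2 * s w - a₁) z := by fun_prop
    exact this.eventually_ne hA
  have eB : ∀ᶠ w in 𝓝 z, 2 * w.2 + w.1 * s w - a₂ ≠ 0 := by
    have : ContinuousAt (fun w : ℂ × ℂ => 2 * w.2 + w.1 * s w - a₂) z := by fun_prop
    exact this.eventually_ne hB
  obtain ⟨ε, hε, hb⟩ := Metric.eventually_nhds_iff_ball.1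
    (hs.eventually_analyticAt.and (eA.and eB))
  have hK := H (Metric.ball z ε) Metric.isOpen_ball ⟨z, Metric.mem_ball_self hε⟩
    ⟨⟨z, Metric.mem_ball_self hε⟩, (convex_ball z ε).isPreconnected⟩ s
    (fun w hw => (hb w hw).1) (fun w _ => hP w) (fun w hw => (hb w hw).2.1)
    (fun w hw => (hb w hw).2.2) z (Metric.mem_ball_self hε)
  obtain ⟨p, q, r, hp, hq, hr, -, h1, h2, h3, h4, h5, h6⟩ :=
    aux_calc a₁ a₂ a₃ a₄ s z hs (Eventually.of_forall hP)
  rw [h1, h2, h3, h4, h5, h6] at hK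
  have hC : 2 * s z + z.1 * z.2 - a₃ ≠ 0 := by
    intro h
    rw [h, zero_mul] at hp
    exact hA (neg_eq_zero.1 hp.symm)
  have ep : auxp a₁ a₃ z.1 z.2 (s z) = p := by
    unfold auxp auxA auxC; rw [div_eq_iff hC, ← hp]; ring
  have eq : auxq a₂ a₃ z.1 z.2 (s z) = q := by
    unfold auxq auxB auxC; rw [div_eq_iff hC, ← hq]; ring
  have er : auxr a₁ a₂ a₃ z.1 z.2 (s z) = r := by
    unfold auxr; rw [ep, eq]; unfold auxC; rw [div_eq_iff hC, ← hr]; ring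
  unfold auxN
  rw [ep, eq, er]
  unfold auxA auxB
  rw [div_sub_div _ _ (pow_ne_zero 2 hA) (pow_ne_zero 2 hB), div_eq_zero_iff] at hK
  rcases hK with hK | hK
  · linear_combination hK
  · exact absurd hK (mul_ne_zero (pow_ne_zero 2 hA) (pow_ne_zero 2 hB))

lemma aux_key (a₁ a₂ a₃ a₄ : ℂ) (H : auxH a₁ a₂ a₃ a₄) (x₀ y₀ z₀ : ℂ)
    (hP : x₀ ^ 2 + y₀ ^ 2 + z₀ ^ 2 + x₀ * y₀ * z₀ - a₁ * x₀ - a₂ * y₀ - a₃ * z₀ - a₄ = 0)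
    (hA : 2 * x₀ + y₀ * z₀ - a₁ = 0) (hB : 2 * y₀ + x₀ * z₀ - a₂ ≠ 0)
    (hC : 2 * z₀ + x₀ * y₀ - a₃ ≠ 0) :
    z₀ * (2 * z₀ + x₀ * y₀ - a₃) = y₀ * (2 * y₀ + x₀ * z₀ - a₂) := by
  obtain ⟨s, hs0, hs, hPs⟩ := aux_sec a₁ a₂ a₃ a₄ x₀ y₀ z₀ hP hC
  obtain ⟨p, q, r, hp, -, -, hd, -⟩ :=
    aux_calc a₁ a₂ a₃ a₄ s (x₀, y₀) hs (Eventually.of_forall hPs)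
  simp only [hs0] at hp hd
  have hp0 : p = 0 := by
    rw [hA, neg_zero] at hp
    exact (mul_eq_zero.1 hp).resolve_left hC
  subst hp0
  have hdA : HasDerivAt (fun x => 2 * x + y₀ * s (x, y₀) - a₁) 2 x₀ := by
    have := ((((hasDerivAt_id x₀).const_mul 2)).add (hd.const_mul y₀)).sub_const a₁
    refine this.congr_deriv ?_
    simp
  have hne : ∀ᶠ x in 𝓝[≠] x₀, 2 * x + y₀ * s (x, y₀) - a₁ ≠ 0 :=
    hdA.eventually_ne (by norm_num)
  have hsc := hd.continuousAt
  have hBe : ∀ᶠ x in 𝓝[≠] x₀, 2 * y₀ + x * s (x, y₀) - a₂ ≠ 0 := by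
    have : ContinuousAt (fun x : ℂ => 2 * y₀ + x * s (x, y₀) - a₂) x₀ := by fun_prop
    exact (this.eventually_ne (by simpa only [hs0] using hB)).filter_mono nhdsWithin_le_nhds
  have hse : ∀ᶠ x in 𝓝[≠] x₀, AnalyticAt ℂ s (x, y₀) :=
    (aux_slice1 hs.eventually_analyticAt).filter_mono nhdsWithin_le_nhds
  have hN : ∀ᶠ x in 𝓝[≠] x₀, auxN a₁ a₂ a₃ x y₀ (s (x, y₀)) = 0 := by
    filter_upwards [hne, hBe, hse] with x h1 h2 h3
    exact aux_N a₁ a₂ a₃ a₄ H s (x, y₀) h3 hPs h1 h2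
  have hcont := auxN_cont a₁ a₂ a₃ y₀ x₀ (fun x => s (x, y₀)) hsc
    (by simpa only [hs0, auxC] using hC)
  have h0 : auxN a₁ a₂ a₃ x₀ y₀ (s (x₀, y₀)) = 0 := by
    refine tendsto_nhds_unique (hcont.tendsto.mono_left nhdsWithin_le_nhds)
      ((tendsto_const_nhds (x := (0 : ℂ)) (f := 𝓝[≠] x₀)).congr' ?_)
    filter_upwards [hN] with x hx using hx.symm
  rw [hs0] at h0
  have eA : auxA a₁ x₀ y₀ z₀ = 0 := hA
  have ep : auxp a₁ a₃ x₀ y₀ z₀ = 0 := by unfold auxp; rw [eA]; simp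
  unfold auxN at h0
  rw [ep, eA] at h0
  have h1 : (z₀ + y₀ * auxq a₂ a₃ x₀ y₀ z₀) * (auxB a₂ x₀ y₀ z₀) ^ 2 = 0 := by
    linear_combination (-1 / 2) * h0
  have h2 := (mul_eq_zero.1 h1).resolve_right (pow_ne_zero 2 hB)
  have h3 : auxq a₂ a₃ x₀ y₀ z₀ * (2 * z₀ + x₀ * y₀ - a₃) = - (2 * y₀ + x₀ * z₀ - a₂) := by
    unfold auxq auxC auxB; rw [div_mul_cancel₀ _ hC]
  linear_combination (2 * z₀ + x₀ * y₀ - a₃) * h2 - y₀ * h3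

lemma aux_fwd (x y s p q r : ℂ)
    (hP : x ^ 2 + y ^ 2 + s ^ 2 + x * y * s - 4 = 0)
    (hA : 2 * x + y * s ≠ 0)
    (hp : (2 * s + x * y) * p = - (2 * x + y * s))
    (hq : (2 * s + x * y) * q = - (2 * y + x * s))
    (hr : (2 * s + x * y) * r = - (2 * p * q + y * q + x * p + s)) :
    ((p + y * r) * (2 * x + y * s) - (2 + y * p) * (s + y * q)) * (2 * y + x * s) ^ 2
    = ((q + x * r) * (2 * y + x * s) - (s + x * p) * (2 + x * q)) * (2 * x + y * s) ^ 2 := by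
  have hC : 2 * s + x * y ≠ 0 := by
    intro h
    rw [h, zero_mul] at hp
    exact hA (neg_eq_zero.1 hp.symm)
  have A2 : (2 * x + y * s) ^ 2 = (y ^ 2 - 4) * (s ^ 2 - 4) := by linear_combination 4 * hP
  have B2 : (2 * y + x * s) ^ 2 = (x ^ 2 - 4) * (s ^ 2 - 4) := by linear_combination 4 * hP
  have e1 : 2 * x + y * s = q * (y ^ 2 - 4) := by
    apply mul_left_cancel₀ hC
    linear_combination (- (y ^ 2 - 4)) * hq + (2 * y) * hP
  have e2 : 2 * y + x * s = p * (x ^ 2 - 4) := by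
    apply mul_left_cancel₀ hC
    linear_combination (- (x ^ 2 - 4)) * hp + (2 * x) * hP
  have e0 : 2 * p * q + y * q + x * p = 0 := by
    apply mul_left_cancel₀ hC
    apply mul_left_cancel₀ hC
    linear_combination (2 * ((2 * s + x * y) * q) + (2 * s + x * y) * x) * hp
      + (-2 * (2 * x + y * s) + (2 * s + x * y) * y) * hq + (4 * s - 2 * (2 * s + x * y)) * hP
  have e3 : 2 + y * p = r * (y ^ 2 - 4) := by
    apply mul_left_cancel₀ hC
    linear_combination y * hp - (y ^ 2 - 4) * hr + (y ^ 2 - 4) * e0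
  have e4 : 2 + x * q = r * (x ^ 2 - 4) := by
    apply mul_left_cancel₀ hC
    linear_combination x * hq - (x ^ 2 - 4) * hr + (x ^ 2 - 4) * e0
  rw [A2, B2, e1, e2, e3, e4]
  ring

lemma aux_lim (a₁ a₂ a₃ a₄ : ℂ) (H : auxH a₁ a₂ a₃ a₄) (σ : ℂ) (hσ : σ ^ 2 = 1) :
    2 * a₂ - a₁ * (2 * σ) = 0 ∧
    (a₁ = 0 → a₂ = 0 → -16 + 8 * σ * a₃ + 4 * a₄ = 0) := by
  have hσ0 : σ ≠ 0 := by rintro rfl; norm_num at hσ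
  obtain ⟨Z, hZ, hZ0, hE⟩ := aux_root a₁ a₂ a₃ a₄ σ hσ
  have n1 : ∀ᶠ e in 𝓝 (0 : ℂ), 2 * (Z e) ^ 2 * e ^ 2 - a₃ * Z e * e ^ 2 - 2 + a₂ * e ≠ 0 := by
    have : ContinuousAt (fun e : ℂ => 2 * (Z e) ^ 2 * e ^ 2 - a₃ * Z e * e ^ 2 - 2 + a₂ * e) 0 := by
      fun_prop
    exact this.eventually_ne (by norm_num)
  have n2 : ∀ᶠ e in 𝓝 (0 : ℂ), 2 * Z e * e ^ 2 + (a₁ * e - Z e) / 2 - a₃ * e ^ 2 ≠ 0 := by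
    have : ContinuousAt (fun e : ℂ => 2 * Z e * e ^ 2 + (a₁ * e - Z e) / 2 - a₃ * e ^ 2) 0 := by
      fun_prop
    exact this.eventually_ne (by simp [hZ0, hσ0])
  have main : ∀ᶠ e in 𝓝[≠] (0 : ℂ),
      (2 * a₂ - a₁ * Z e) + e * (-4 * (Z e) ^ 2 + 4 * a₃ * Z e + a₁ ^ 2 + 4 * a₄) = 0 := by
    filter_upwards [hE.filter_mono nhdsWithin_le_nhds, n1.filter_mono nhdsWithin_le_nhds,
      n2.filter_mono nhdsWithin_le_nhds, self_mem_nhdsWithin] with e h1 h2 h3 he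
    have he : e ≠ 0 := he
    generalize Z e = z at *
    obtain ⟨y, hy⟩ : ∃ y, y * e = 1 := ⟨e⁻¹, inv_mul_cancel₀ he⟩
    have hB : 2 * y + ((a₁ - y * z) / 2) * z - a₂ = 0 := by
      by_contra hB
      have := aux_key a₁ a₂ a₃ a₄ H ((a₁ - y * z) / 2) y z
        (by
          apply mul_left_cancel₀ (pow_ne_zero 2 he)
          obtain rfl : y = e⁻¹ := eq_inv_of_mul_eq_one_left hy
          field_simp
          linear_combination (-1) * h1)
        (by ring) hB
        (by
          intro h
          apply h3
          obtain rfl : y = e⁻¹ := eq_inv_of_mul_eq_one_left hy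
          field_simp at h ⊢
          linear_combination h)
      apply h2
      obtain rfl : y = e⁻¹ := eq_inv_of_mul_eq_one_left hy
      field_simp at this ⊢
      linear_combination this / 2
    apply mul_left_cancel₀ he
    obtain rfl : y = e⁻¹ := eq_inv_of_mul_eq_one_left hy
    field_simp at hB
    linear_combination hB + h1
  constructor
  · have hc : ContinuousAt (fun e : ℂ =>
      (2 * a₂ - a₁ * Z e) + e * (-4 * (Z e) ^ 2 + 4 * a₃ * Z e + a₁ ^ 2 + 4 * a₄)) 0 := by fun_prop
    have h0 := tendsto_nhds_unique (hc.tendsto.mono_left nhdsWithin_le_nhds)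
      ((tendsto_const_nhds (x := (0 : ℂ)) (f := 𝓝[≠] (0 : ℂ))).congr'
        (by filter_upwards [main] with x hx using hx.symm))
    rw [hZ0] at h0
    linear_combination h0
  · rintro rfl rfl
    have hc : ContinuousAt (fun e : ℂ =>
      (-4 * (Z e) ^ 2 + 4 * a₃ * Z e + 4 * a₄)) 0 := by fun_prop
    have h0 := tendsto_nhds_unique (hc.tendsto.mono_left nhdsWithin_le_nhds)
      ((tendsto_const_nhds (x := (0 : ℂ)) (f := 𝓝[≠] (0 : ℂ))).congr'
        (by
          filter_upwards [main, self_mem_nhdsWithin] with x hx hx0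
          have hx0 : x ≠ 0 := hx0
          apply mul_left_cancel₀ hx0
          linear_combination -hx))
    rw [hZ0] at h0
    linear_combination h0 + 16 * hσ

/-- The 3-web `(ker dx1, ker dx2, ker dx3)` on the character variety `S_𝐚` is locally
parallelizable (its Blaschke curvature, computed in the chart `(x1,x2)` via a local section
`x3 = s(x1,x2)`, vanishes) if and only if `𝐚 = (0,0,0,4)`. -/
theorem stmt13 (a₁ a₂ a₃ a₄ : ℂ) :
    (a₁ = 0 ∧ a₂ = 0 ∧ a₃ = 0 ∧ a₄ = 4) ↔
    (∀ V : Set (ℂ × ℂ), IsOpen V → V.Nonempty → IsConnected V →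
      ∀ s : ℂ × ℂ → ℂ, AnalyticOnNhd ℂ s V →
      (∀ z ∈ V, z.1 ^ 2 + z.2 ^ 2 + (s z) ^ 2 + z.1 * z.2 * s z
          - a₁ * z.1 - a₂ * z.2 - a₃ * s z - a₄ = 0) →
      (∀ z ∈ V, 2 * z.1 + z.2 * s z - a₁ ≠ 0) →
      (∀ z ∈ V, 2 * z.2 + z.1 * s z - a₂ ≠ 0) →
      ∀ z ∈ V,
        (pdx (pdy (fun w => 2 * w.1 + w.2 * s w - a₁)) z
              * (2 * z.1 + z.2 * s z - a₁)
            - pdx (fun w => 2 * w.1 + w.2 * s w - a₁) z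
              * pdy (fun w => 2 * w.1 + w.2 * s w - a₁) z)
          / (2 * z.1 + z.2 * s z - a₁) ^ 2
        - (pdx (pdy (fun w => 2 * w.2 + w.1 * s w - a₂)) z
              * (2 * z.2 + z.1 * s z - a₂)
            - pdx (fun w => 2 * w.2 + w.1 * s w - a₂) z
              * pdy (fun w => 2 * w.2 + w.1 * s w - a₂) z)
          / (2 * z.2 + z.1 * s z - a₂) ^ 2 = 0) := by
  constructor
  · rintro ⟨rfl, rfl, rfl, rfl⟩ V hV - - s hs hP hA hB z hz
    obtain ⟨p, q, r, hp, hq, hr, -, h1, h2, h3, h4, h5, h6⟩ :=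
      aux_calc 0 0 0 4 s z (hs z hz)
        (by filter_upwards [hV.mem_nhds hz] with w hw using hP w hw)
    rw [h1, h2, h3, h4, h5, h6]
    have hA' := hA z hz
    have hB' := hB z hz
    have hP' := hP z hz
    simp only [sub_zero, zero_mul] at *
    rw [sub_eq_zero, div_eq_div_iff (pow_ne_zero 2 hA') (pow_ne_zero 2 hB')]
    exact aux_fwd z.1 z.2 (s z) p q r hP' hA' hp hq hr
  · intro H
    obtain ⟨u1, u2⟩ := aux_lim a₁ a₂ a₃ a₄ H 1 (by norm_num)
    obtain ⟨v1, v2⟩ := aux_lim a₁ a₂ a₃ a₄ H (-1) (by norm_num)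
    have e1 : a₁ = 0 := by linear_combination (v1 - u1) / 4
    have e2 : a₂ = 0 := by linear_combination (v1 + u1) / 4
    have w1 := u2 e1 e2
    have w2 := v2 e1 e2
    refine ⟨e1, e2, ?_, ?_⟩
    · linear_combination (w1 - w2) / 16
    · linear_combination (w1 + w2) / 8
end
end

section
/- The following are equivalent: (i) (a1,a2,a3,a4) = (0,0,0,4); (ii) for every nonempty connected open V ⊂ ℂ² and every holomorphic s : V → ℂ with P_𝐚(x1, x2, s(x1,x2)) = 0 on V and such that 2·s(x1,x2) + x1x2 − a3 vanishes nowhere on V, the function f(x1,x2) := 1/(2·s(x1,x2) + x1x2 − a3) satisfies (∂_{x1}∂_{x2} f)·f = (∂_{x1} f)·(∂_{x2} f) identically on V. (This is the statement that the bi-Lagrangian manifold (S_𝐚, Ω, ker dx1, ker dx2) has flat Hess connection iff 𝐚 = (0,0,0,4).) -/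
noncomputable section

def qD (a₁ a₂ a₃ a₄ x y : ℂ) : ℂ := (x * y - a₃) ^ 2 - 4 * (x ^ 2 + y ^ 2 - a₁ * x - a₂ * y - a₄)
def qX (a₁ a₃ x y : ℂ) : ℂ := 2 * x * y ^ 2 - 2 * a₃ * y - 8 * x + 4 * a₁
def qY (a₂ a₃ x y : ℂ) : ℂ := 2 * x ^ 2 * y - 2 * a₃ * x - 8 * y + 4 * a₂

lemma qD_x (a₁ a₂ a₃ a₄ x y : ℂ) :
    HasDerivAt (fun t => qD a₁ a₂ a₃ a₄ t y) (qX a₁ a₃ x y) x := by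
  unfold qD qX
  have h := hasDerivAt_id' x
  refine HasDerivAt.congr_deriv ((((h.mul_const y).sub_const a₃).pow 2).sub
    ((((((h.pow 2).add_const (y ^ 2)).sub (h.const_mul a₁)).sub_const (a₂ * y)).sub_const
      a₄).const_mul 4)) ?_
  norm_num
  ring

lemma qD_y (a₁ a₂ a₃ a₄ x y : ℂ) :
    HasDerivAt (fun t => qD a₁ a₂ a₃ a₄ x t) (qY a₂ a₃ x y) y := by
  have h := qD_x a₂ a₁ a₃ a₄ y x
  convert h using 1
  · funext t; unfold qD; ring
  · unfold qX qY; ring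

lemma qY_x (a₂ a₃ x y : ℂ) :
    HasDerivAt (fun t => qY a₂ a₃ t y) (4 * x * y - 2 * a₃) x := by
  unfold qY
  have h := hasDerivAt_id' x
  refine HasDerivAt.congr_deriv ((((((h.pow 2).const_mul 2).mul_const y).sub (h.const_mul (2 * a₃))).sub_const
    (8 * y)).add_const (4 * a₂)) ?_
  simp only [Nat.cast_ofNat]
  ring

lemma sqrt_deriv (g q : ℂ → ℂ) (q' t : ℂ) (hg : DifferentiableAt ℂ g t) (h0 : g t ≠ 0)
    (hq : HasDerivAt q q' t) (he : ∀ᶠ u in nhds t, g u ^ 2 = q u) :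
    HasDerivAt g (q' / (2 * g t)) t := by
  have h1 := hg.hasDerivAt.pow 2
  have h2 := (hq.congr_of_eventuallyEq he).unique h1
  have : q' / (2 * g t) = deriv g t := by
    rw [h2]; field_simp; norm_num; ring
  rw [this]; exact hg.hasDerivAt

lemma key (a₁ a₂ a₃ a₄ : ℂ) (V : Set (ℂ × ℂ)) (hV : IsOpen V) (g : ℂ × ℂ → ℂ)
    (hg : AnalyticOnNhd ℂ g V) (hsq : ∀ z ∈ V, g z ^ 2 = qD a₁ a₂ a₃ a₄ z.1 z.2)
    (h0 : ∀ z ∈ V, g z ≠ 0) (z : ℂ × ℂ) (hz : z ∈ V) :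
    pdx (pdy (fun w => 1 / g w)) z * (1 / g z)
      = pdx (fun w => 1 / g w) z * pdy (fun w => 1 / g w) z ↔
    qD a₁ a₂ a₃ a₄ z.1 z.2 * (4 * z.1 * z.2 - 2 * a₃)
      = qX a₁ a₃ z.1 z.2 * qY a₂ a₃ z.1 z.2 := by
  have evx : ∀ z ∈ V, ∀ᶠ u in nhds z.1, (u, z.2) ∈ V := fun z hz =>
    (Continuous.prodMk_left z.2).continuousAt.eventually (hV.mem_nhds hz)
  have evy : ∀ z ∈ V, ∀ᶠ u in nhds z.2, (z.1, u) ∈ V := fun z hz =>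
    (Continuous.prodMk_right z.1).continuousAt.eventually (hV.mem_nhds hz)
  have gx : ∀ z ∈ V, HasDerivAt (fun x => g (x, z.2)) (qX a₁ a₃ z.1 z.2 / (2 * g z)) z.1 := by
    intro z hz
    refine sqrt_deriv (fun x => g (x, z.2)) _ _ _ ?_ (h0 z hz) (qD_x a₁ a₂ a₃ a₄ z.1 z.2) ?_
    · have : DifferentiableAt ℂ g (z.1, z.2) := (hg z hz).differentiableAt
      exact DifferentiableAt.comp (f := fun x : ℂ => (x, z.2)) z.1 this (by fun_prop)
    · filter_upwards [evx z hz] with u hu using hsq _ hu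
  have gy : ∀ z ∈ V, HasDerivAt (fun y => g (z.1, y)) (qY a₂ a₃ z.1 z.2 / (2 * g z)) z.2 := by
    intro z hz
    refine sqrt_deriv (fun y => g (z.1, y)) _ _ _ ?_ (h0 z hz) (qD_y a₁ a₂ a₃ a₄ z.1 z.2) ?_
    · have : DifferentiableAt ℂ g (z.1, z.2) := (hg z hz).differentiableAt
      exact DifferentiableAt.comp (f := fun y : ℂ => (z.1, y)) z.2 this (by fun_prop)
    · filter_upwards [evy z hz] with u hu using hsq _ hu
  have fx : ∀ z ∈ V, pdx (fun w => 1 / g w) z = -(qX a₁ a₃ z.1 z.2) / (2 * g z ^ 3) := by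
    intro z hz
    have hn := h0 z hz
    have := ((gx z hz).inv hn).deriv
    simp only [pdx, one_div]
    refine Eq.trans this ?_
    change -(_ / (2 * g z)) / g z ^ 2 = _
    field_simp
  have fy : ∀ z ∈ V, pdy (fun w => 1 / g w) z = -(qY a₂ a₃ z.1 z.2) / (2 * g z ^ 3) := by
    intro z hz
    have hn := h0 z hz
    have := ((gy z hz).inv hn).deriv
    simp only [pdy, one_div]
    refine Eq.trans this ?_
    change -(_ / (2 * g z)) / g z ^ 2 = _
    field_simp
  have hn := h0 z hz
  have fxy : pdx (pdy (fun w => 1 / g w)) z = -(4 * z.1 * z.2 - 2 * a₃) / (2 * g z ^ 3)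
      + 3 * (qX a₁ a₃ z.1 z.2 * qY a₂ a₃ z.1 z.2) / (4 * g z ^ 5) := by
    have h1 : (fun x => pdy (fun w => 1 / g w) (x, z.2)) =ᶠ[nhds z.1]
        fun x => -(qY a₂ a₃ x z.2) / (2 * g (x, z.2) ^ 3) := by
      filter_upwards [evx z hz] with u hu using fy _ hu
    have h2 := ((qY_x a₂ a₃ z.1 z.2).fun_neg).fun_div (((gx z hz).fun_pow 3).const_mul 2)
      (mul_ne_zero two_ne_zero (pow_ne_zero 3 hn))
    refine Eq.trans h1.deriv_eq (Eq.trans h2.deriv ?_)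
    simp only [Prod.mk.eta]
    norm_num
    field_simp
    ring
  rw [fxy, fx z hz, fy z hz, ← hsq z hz]
  generalize qX a₁ a₃ z.1 z.2 = X
  generalize qY a₂ a₃ z.1 z.2 = Y
  generalize g z = G at hn
  generalize 4 * z.1 * z.2 - 2 * a₃ = M
  have : (-M / (2 * G ^ 3) + 3 * (X * Y) / (4 * G ^ 5)) * (1 / G)
      - -X / (2 * G ^ 3) * (-Y / (2 * G ^ 3)) = (X * Y - G ^ 2 * M) / (2 * G ^ 6) := by
    field_simp; ring
  rw [← sub_eq_zero, this, div_eq_zero_iff, or_iff_left (by simpa using hn), sub_eq_zero, eq_comm]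

lemma exists_qD (a₁ a₂ a₃ a₄ : ℂ) : ∃ p : ℂ × ℂ, qD a₁ a₂ a₃ a₄ p.1 p.2 ≠ 0 := by
  by_contra! h
  have e := fun x y : ℂ => h (x, y)
  simp only [qD] at e
  have : (1 : ℂ) = 0 := by
    linear_combination (e 1 1 + e 1 (-1) + e (-1) 1 + e (-1) (-1)) / 4
      - (e 1 0 + e (-1) 0 + e 0 1 + e 0 (-1)) / 2 + e 0 0
  exact one_ne_zero this

lemma coeffs (a₁ a₂ a₃ a₄ : ℂ) (h : ∀ x y : ℂ,
    qD a₁ a₂ a₃ a₄ x y * (4 * x * y - 2 * a₃) - qX a₁ a₃ x y * qY a₂ a₃ x y = 0) :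
    a₁ = 0 ∧ a₂ = 0 ∧ a₃ = 0 ∧ a₄ = 4 := by
  simp only [qD, qX, qY] at h
  have h3 : a₃ = 0 := by
    linear_combination (-1 / 2) * ((h 1 1 + h 1 (-1) + h (-1) 1 + h (-1) (-1)) / 4
      - (h 1 0 + h (-1) 0 + h 0 1 + h 0 (-1)) / 2 + h 0 0)
  subst h3
  have h1 : a₁ = 0 := by linear_combination (h 0 1 - h 0 0) / 32
  have h2 : a₂ = 0 := by linear_combination (h 1 0 - h 0 0) / 32
  subst h1 h2
  exact ⟨rfl, rfl, rfl, by linear_combination (h 1 1) / 16⟩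

/-- The bi-Lagrangian manifold `(S_𝐚, Ω, ker dx1, ker dx2)` has flat Hess connection
(i.e. `f·f_{x1x2} = f_{x1}·f_{x2}` for `f = 1/(2s + x1x2 − a3)` in any chart given by a local
section `x3 = s(x1,x2)`) if and only if `𝐚 = (0,0,0,4)`. -/
theorem stmt14 (a₁ a₂ a₃ a₄ : ℂ) :
    (a₁ = 0 ∧ a₂ = 0 ∧ a₃ = 0 ∧ a₄ = 4) ↔
    (∀ V : Set (ℂ × ℂ), IsOpen V → V.Nonempty → IsConnected V →
      ∀ s : ℂ × ℂ → ℂ, AnalyticOnNhd ℂ s V →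
      (∀ z ∈ V, z.1 ^ 2 + z.2 ^ 2 + (s z) ^ 2 + z.1 * z.2 * s z
          - a₁ * z.1 - a₂ * z.2 - a₃ * s z - a₄ = 0) →
      (∀ z ∈ V, 2 * s z + z.1 * z.2 - a₃ ≠ 0) →
      ∀ z ∈ V,
        pdx (pdy (fun w => 1 / (2 * s w + w.1 * w.2 - a₃))) z
            * (1 / (2 * s z + z.1 * z.2 - a₃))
          = pdx (fun w => 1 / (2 * s w + w.1 * w.2 - a₃)) z
            * pdy (fun w => 1 / (2 * s w + w.1 * w.2 - a₃)) z) := by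
  constructor
  · rintro ⟨rfl, rfl, rfl, rfl⟩ V hV - - s hs hP h0 z hz
    refine (key 0 0 0 4 V hV (fun w => 2 * s w + w.1 * w.2 - 0) ?_ ?_ h0 z hz).2 ?_
    · intro w hw
      have := hs w hw
      fun_prop
    · intro w hw
      simp only [qD]
      linear_combination 4 * hP w hw
    · simp only [qD, qX, qY]; ring
  · intro H
    obtain ⟨p, hp⟩ := exists_qD a₁ a₂ a₃ a₄
    set D : ℂ × ℂ → ℂ := fun w => qD a₁ a₂ a₃ a₄ w.1 w.2 with hD
    have hDa : AnalyticOnNhd ℂ D Set.univ := by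
      intro w _
      have hf : AnalyticAt ℂ (fun u : ℂ × ℂ => u.1) w := analyticAt_fst
      have hs : AnalyticAt ℂ (fun u : ℂ × ℂ => u.2) w := analyticAt_snd
      simp only [hD, qD]
      fun_prop
    have hDc : Continuous D := by
      simp only [hD, qD]
      fun_prop
    obtain ⟨c, hc⟩ : ∃ c : ℂ, D p = c ^ 2 := by
      obtain ⟨c, hc⟩ := IsAlgClosed.exists_pow_nat_eq (D p) (n := 2) (by norm_num)
      exact ⟨c, hc.symm⟩
    have hp' : D p ≠ 0 := hp
    have hc0 : c ≠ 0 := by rintro rfl; simp at hc; exact hp' hc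
    have hopen : IsOpen {w | D w / D p ∈ Complex.slitPlane} :=
      Complex.isOpen_slitPlane.preimage (hDc.div_const _)
    obtain ⟨r, hr, hball⟩ := Metric.isOpen_iff.1 hopen p (by
      simp [div_self hp'])
    set V := Metric.ball p r with hVdef
    have hpV : p ∈ V := Metric.mem_ball_self hr
    obtain ⟨g, hgdef⟩ : ∃ g : ℂ × ℂ → ℂ, g = fun w => c * Complex.exp (Complex.log (D w / D p) / 2) := ⟨_, rfl⟩
    have hga : AnalyticOnNhd ℂ g V := by
      intro w hw
      have h1 := hDa w (Set.mem_univ _)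
      have h2 : AnalyticAt ℂ (fun w => Complex.log (D w / D p)) w :=
        (h1.div analyticAt_const hp').clog (hball hw)
      rw [hgdef]
      exact analyticAt_const.mul (h2.div analyticAt_const two_ne_zero).cexp
    have hg0 : ∀ w ∈ V, g w ≠ 0 := fun w _ => hgdef ▸ mul_ne_zero hc0 (Complex.exp_ne_zero _)
    have hgsq : ∀ w ∈ V, g w ^ 2 = D w := by
      intro w hw
      have hne : D w / D p ≠ 0 := Complex.slitPlane_ne_zero (hball hw)
      simp only [hgdef]
      rw [mul_pow, ← Complex.exp_nat_mul, ← hc]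
      have : ((2 : ℕ) : ℂ) * (Complex.log (D w / D p) / 2) = Complex.log (D w / D p) := by
        push_cast; ring
      rw [this, Complex.exp_log hne]
      field_simp
    have hgs : ∀ w : ℂ × ℂ, 2 * ((g w - w.1 * w.2 + a₃) / 2) + w.1 * w.2 - a₃ = g w := by
      intro w; ring
    have HV := H V Metric.isOpen_ball ⟨p, hpV⟩
      ⟨⟨p, hpV⟩, (convex_ball p r).isPreconnected⟩
      (fun w => (g w - w.1 * w.2 + a₃) / 2) (by
        intro w hw
        have := hga w hw
        simp only [div_eq_mul_inv]
        fun_prop) (by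
        intro w hw
        have := hgsq w hw
        simp only [hD, qD] at this
        linear_combination this / 4) (by
        intro w hw
        rw [hgs]
        exact hg0 w hw)
    simp only [hgs] at HV
    apply coeffs
    have hE : AnalyticOnNhd ℂ (fun w : ℂ × ℂ => D w * (4 * w.1 * w.2 - 2 * a₃)
        - qX a₁ a₃ w.1 w.2 * qY a₂ a₃ w.1 w.2) Set.univ := by
      intro w _
      have hf : AnalyticAt ℂ (fun u : ℂ × ℂ => u.1) w := analyticAt_fst
      have hs : AnalyticAt ℂ (fun u : ℂ × ℂ => u.2) w := analyticAt_snd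
      simp only [hD, qD, qX, qY]
      fun_prop
    have hvan : ∀ w ∈ V, D w * (4 * w.1 * w.2 - 2 * a₃)
        - qX a₁ a₃ w.1 w.2 * qY a₂ a₃ w.1 w.2 = 0 := by
      intro w hw
      have hk := (key a₁ a₂ a₃ a₄ V Metric.isOpen_ball g hga hgsq hg0 w hw).1 (HV w hw)
      exact sub_eq_zero.2 hk
    have hz := hE.eqOn_zero_of_preconnected_of_eventuallyEq_zero isPreconnected_univ
      (Set.mem_univ p) (by
        filter_upwards [Metric.isOpen_ball.mem_nhds hpV] with w hw
        exact hvan w hw)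
    intro x y
    have hxy := hz (Set.mem_univ (x, y))
    simp only [Pi.zero_apply, hD] at hxy
    exact hxy
end
end

section
/- Let Q(x1,x2,x3) = x1x2x3 + x1 + x2 + 1 (the character variety of Painlevé I). Let V ⊂ ℂ² be a nonempty connected open set and s : V → ℂ holomorphic with Q(x1, x2, s(x1,x2)) = 0 on V, and suppose A(x1,x2) = x2·s(x1,x2) + 1 and B(x1,x2) = x1·s(x1,x2) + 1 vanish nowhere on V. Then the Blaschke curvature K := ((∂_{x1}∂_{x2}A)·A − (∂_{x1}A)·(∂_{x2}A))/A² − ((∂_{x1}∂_{x2}B)·B − (∂_{x1}B)·(∂_{x2}B))/B² vanishes identically on V; i.e. the 3-web (ker dx1, ker dx2, ker dx3) on the PI character variety is parallelizable. -/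
noncomputable section

theorem pdx_congr_aux {f g : ℂ × ℂ → ℂ} {z : ℂ × ℂ} (h : f =ᶠ[nhds z] g) : pdx f z = pdx g z := by
  unfold pdx
  apply Filter.EventuallyEq.deriv_eq
  have hc : Filter.Tendsto (fun x : ℂ => (x, z.2)) (nhds z.1) (nhds z) := by
    have : Continuous (fun x : ℂ => (x, z.2)) := by fun_prop
    exact this.tendsto z.1
  exact hc.eventually h

theorem pdy_congr_aux {f g : ℂ × ℂ → ℂ} {z : ℂ × ℂ} (h : f =ᶠ[nhds z] g) : pdy f z = pdy g z := by
  unfold pdy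
  apply Filter.EventuallyEq.deriv_eq
  have hc : Filter.Tendsto (fun y : ℂ => (z.1, y)) (nhds z.2) (nhds z) := by
    have : Continuous (fun y : ℂ => (z.1, y)) := by fun_prop
    exact this.tendsto z.2
  exact hc.eventually h

theorem sep_aux (V : Set (ℂ × ℂ)) (hV : IsOpen V) (f : ℂ × ℂ → ℂ) (u v : ℂ → ℂ)
    (h : ∀ z ∈ V, f z = u z.1 * v z.2) (z : ℂ × ℂ) (hz : z ∈ V) :
    pdx (pdy f) z * f z - pdx f z * pdy f z = 0 := by
  have he : ∀ w ∈ V, f =ᶠ[nhds w] fun w => u w.1 * v w.2 := fun w hw => by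
    filter_upwards [hV.mem_nhds hw] with a ha using h a ha
  have hx : pdx f z = deriv u z.1 * v z.2 := by
    rw [pdx_congr_aux (he z hz)]
    simp [pdx]
  have hy : ∀ w ∈ V, pdy f w = u w.1 * deriv v w.2 := fun w hw => by
    rw [pdy_congr_aux (he w hw)]
    simp [pdy]
  have hxy : pdx (pdy f) z = deriv u z.1 * deriv v z.2 := by
    have : pdy f =ᶠ[nhds z] fun w => u w.1 * deriv v w.2 := by
      filter_upwards [hV.mem_nhds hz] with a ha using hy a ha
    rw [pdx_congr_aux this]
    simp [pdx]
  rw [hx, hy z hz, hxy, h z hz]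
  ring

/-- An open set cannot meet the coordinate axes inside the locus of a section. -/
theorem axis_aux (c : ℂ) (W : Set ℂ) (hW : IsOpen W) (h : ∀ y ∈ W, y = c) (y : ℂ) (hy : y ∈ W) :
    False := by
  have h1 : W = {c} := Set.eq_singleton_iff_unique_mem.2 ⟨h y hy ▸ hy, h⟩
  rw [h1] at hW
  exact not_isOpen_singleton c hW

/-- For the Painlevé I character variety `{x1x2x3 + x1 + x2 + 1 = 0}`, in any chart given by
a local section `x3 = s(x1,x2)` with `A = x2·s + 1` and `B = x1·s + 1` nonvanishing, the
Blaschke curvature of the 3-web `(ker dx1, ker dx2, ker dx3)` vanishes identically: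
the web is parallelizable. -/
theorem stmt17 (V : Set (ℂ × ℂ)) (hV : IsOpen V) (hne : V.Nonempty)
    (hconn : IsConnected V) (s : ℂ × ℂ → ℂ) (hs : AnalyticOnNhd ℂ s V)
    (hsec : ∀ z ∈ V, z.1 * z.2 * s z + z.1 + z.2 + 1 = 0)
    (hA : ∀ z ∈ V, z.2 * s z + 1 ≠ 0)
    (hB : ∀ z ∈ V, z.1 * s z + 1 ≠ 0) :
    ∀ z ∈ V,
      (pdx (pdy (fun w => w.2 * s w + 1)) z * (z.2 * s z + 1)
          - pdx (fun w => w.2 * s w + 1) z * pdy (fun w => w.2 * s w + 1) z)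
        / (z.2 * s z + 1) ^ 2
      - (pdx (pdy (fun w => w.1 * s w + 1)) z * (z.1 * s z + 1)
          - pdx (fun w => w.1 * s w + 1) z * pdy (fun w => w.1 * s w + 1) z)
        / (z.1 * s z + 1) ^ 2 = 0 := by
  have h1 : ∀ z ∈ V, z.1 ≠ 0 := by
    intro z hz h0
    refine axis_aux (-1) {y : ℂ | (z.1, y) ∈ V} (hV.preimage (by fun_prop)) ?_ z.2 hz
    intro y hy
    have := hsec _ hy
    simp only [h0] at this
    linear_combination this
  have h2 : ∀ z ∈ V, z.2 ≠ 0 := by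
    intro z hz h0
    refine axis_aux (-1) {x : ℂ | (x, z.2) ∈ V} (hV.preimage (by fun_prop)) ?_ z.1 hz
    intro y hy
    have := hsec _ hy
    simp only [h0] at this
    linear_combination this
  intro z hz
  have hA' := sep_aux V hV (fun w => w.2 * s w + 1) (fun x => -x⁻¹) (fun y => y + 1) (by
    intro w hw
    have := h1 w hw
    have := hsec w hw
    field_simp
    linear_combination this) z hz
  have hB' := sep_aux V hV (fun w => w.1 * s w + 1) (fun x => x + 1) (fun y => -y⁻¹) (by
    intro w hw
    have := h2 w hw
    have := hsec w hw
    field_simp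
    linear_combination this) z hz
  rw [hA', hB']
  simp
end
end

section
/- Let s3 ∈ ℂ and let f : {(x1,x2) ∈ ℂ² : x1x2 ≠ s3} → ℂ be given by f(x1,x2) = 1/(x1x2 − s3). Then the flatness identity (∂_{x1}∂_{x2} f)·f = (∂_{x1} f)·(∂_{x2} f) holds identically if, and only if, s3 = 0. In particular, for the Painlevé V character variety (where s3 ∈ ℂ*), the Hess connection of the bi-Lagrangian structure (S, Ω, ker dx1, ker dx2) is not flat, while for the character varieties of PV^deg, PIII(D6) and PIII(D7) (where the corresponding coefficient is f = 1/(x1x2), i.e. s3 = 0) it is flat. -/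
noncomputable section

theorem aux_pdy (s : ℂ) (z : ℂ × ℂ) (h : z.1 * z.2 ≠ s) :
    pdy (fun w => 1 / (w.1 * w.2 - s)) z = -z.1 / (z.1 * z.2 - s) ^ 2 := by
  have h' := sub_ne_zero.mpr h
  have := ((((hasDerivAt_id z.2).const_mul z.1).sub_const s).fun_inv h')
  simpa [pdy] using this.deriv

theorem aux_pdx (s : ℂ) (z : ℂ × ℂ) (h : z.1 * z.2 ≠ s) :
    pdx (fun w => 1 / (w.1 * w.2 - s)) z = -z.2 / (z.1 * z.2 - s) ^ 2 := by
  have h' := sub_ne_zero.mpr h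
  have := ((((hasDerivAt_id z.1).mul_const z.2).sub_const s).fun_inv h')
  simpa [pdx] using this.deriv

theorem aux_pdxy (s : ℂ) (z : ℂ × ℂ) (h : z.1 * z.2 ≠ s) :
    pdx (pdy (fun w => 1 / (w.1 * w.2 - s))) z
      = (z.1 * z.2 + s) / (z.1 * z.2 - s) ^ 3 := by
  have h' := sub_ne_zero.mpr h
  have hev : (fun x => pdy (fun w => 1 / (w.1 * w.2 - s)) (x, z.2))
      =ᶠ[nhds z.1] fun x => -x / (x * z.2 - s) ^ 2 := by
    have hc : ContinuousAt (fun x : ℂ => x * z.2) z.1 := by fun_prop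
    filter_upwards [hc.eventually_ne h] with x hx
    exact aux_pdy s (x, z.2) hx
  have h1 : HasDerivAt (fun x : ℂ => (x * z.2 - s) ^ 2) _ z.1 :=
    ((((hasDerivAt_id z.1).mul_const z.2).sub_const s).fun_pow 2)
  have h2 := (hasDerivAt_id z.1).fun_neg.fun_div h1 (pow_ne_zero 2 h')
  have h3 := hev.deriv_eq.trans h2.deriv
  unfold pdx
  rw [h3]
  simp only [id]
  field_simp
  push_cast
  ring

/-- For `f(x1,x2) = 1/(x1x2 − s3)` on `{x1x2 ≠ s3}`, the Hess-flatness identity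
`f_{x1x2}·f = f_{x1}·f_{x2}` holds identically if and only if `s3 = 0`.
(Hence the Hess connection of `(S, Ω, ker dx1, ker dx2)` is not flat for the Painlevé V
character variety, where `s3 ∈ ℂ*`, while it is flat for `PV^deg`, `PIII(D6)`, `PIII(D7)`,
where `s3 = 0`.) -/
theorem stmt18 (s₃ : ℂ) :
    (∀ z : ℂ × ℂ, z.1 * z.2 ≠ s₃ →
      pdx (pdy (fun w => 1 / (w.1 * w.2 - s₃))) z * (1 / (z.1 * z.2 - s₃))
        = pdx (fun w => 1 / (w.1 * w.2 - s₃)) z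
          * pdy (fun w => 1 / (w.1 * w.2 - s₃)) z)
    ↔ s₃ = 0 := by
  constructor
  · intro H
    by_contra hs
    have h0 : ((0 : ℂ), (0 : ℂ)).1 * ((0 : ℂ), (0 : ℂ)).2 ≠ s₃ := by
      simpa using Ne.symm hs
    have := H (0, 0) h0
    rw [aux_pdxy _ _ h0, aux_pdx _ _ h0, aux_pdy _ _ h0] at this
    simp [hs] at this
  · rintro rfl z hz
    rw [aux_pdxy _ _ hz, aux_pdx _ _ hz, aux_pdy _ _ hz]
    have h' := sub_ne_zero.mpr hz
    field_simp
    ring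
end
end
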